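/- Let g be a metric on S^n conformal to the round metric g₀ with Vol_g(S^n) = 1. If there exists a cap a ⊂ S^n such that the renormalized measure ν_a is multiple, then λ₂(S^n,g) < K_n · n · (2σ_n)^{2/n}. -/

import Mathlib

open MeasureTheory Metric Real Filter Set
open scoped RealInnerProductSpace ENNReal NNReal Topology Classical

noncomputable section

/-- Ambient Euclidean space `ℝ^{n+1}`. -/
abbrev Eu (n : ℕ) : Type := EuclideanSpace ℝ (Fin (n + 1))

/-- The unit sphere `S^n ⊆ ℝ^{n+1}` as a subset of the ambient space. -/
def sphSet (n : ℕ) : Set (Eu n) := Metric.sphere (0 : Eu n) 1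

/-- The canonical (round) volume measure of `S^n`, viewed as a measure on the
ambient space `ℝ^{n+1}` supported on the unit sphere. -/
def sphMeasure (n : ℕ) : Measure (Eu n) :=
  Measure.map Subtype.val ((volume : Measure (Eu n)).toSphere)

/-- `σ_n`, the volume of the round unit `n`-sphere. -/
def sigmaVol (n : ℕ) : ℝ := (sphMeasure n Set.univ).toReal

/-- The constant `K_n`. -/
def Kconst (n : ℕ) : ℝ :=
  ((n + 1 : ℝ) / n) *
    ((Real.Gamma n * Real.Gamma ((n + 1) / 2)) /
      (Real.Gamma (n + 1 / 2) * Real.Gamma (n / 2))) ^ ((2 : ℝ) / n)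

/-- The linear coordinate function `X_s(x) = s · x`. -/
def Xfun {n : ℕ} (s x : Eu n) : ℝ := ⟪s, x⟫

/-- The tangential gradient on the sphere of (the restriction of) an ambient function:
`∇_{S^n} f (x) = ∇f(x) - ⟨∇f(x), x⟩ x`. -/
def gradS {n : ℕ} (f : Eu n → ℝ) (x : Eu n) : Eu n :=
  gradient f x - ⟪gradient f x, x⟫ • x

/-- A conformal factor `w` represents the metric `g = w² g₀` on `S^n`; it is admissible if it
is smooth and positive on the sphere. -/
def IsConformalFactor (n : ℕ) (w : Eu n → ℝ) : Prop :=
  ContDiff ℝ (⊤ : ℕ∞) w ∧ ∀ x ∈ sphSet n, 0 < w x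

/-- The Riemannian measure `dv_g` of the conformal metric `g = w² g₀`, i.e. `w^n dv_{g₀}`. -/
def confMeasure (n : ℕ) (w : Eu n → ℝ) : Measure (Eu n) :=
  (sphMeasure n).withDensity fun x => ENNReal.ofReal (w x ^ n)

/-- The volume of `(S^n, g)`, `g = w² g₀`. -/
def confVol (n : ℕ) (w : Eu n → ℝ) : ℝ := (confMeasure n w Set.univ).toReal

/-- The Dirichlet energy `∫ |∇_g u|²_g dv_g` of the restriction to `S^n` of `V`,
for `g = w² g₀`: it equals `∫ w^{n-2} |∇_{g₀} V|²_{g₀} dv_{g₀}`. -/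
def dirichlet (n : ℕ) (w : Eu n → ℝ) (V : Eu n → ℝ) : ℝ :=
  ∫ x, w x ^ (n - 2) * ‖gradS V x‖ ^ 2 ∂(sphMeasure n)

/-- `∫ u² dv_g`. -/
def l2sq (n : ℕ) (w : Eu n → ℝ) (V : Eu n → ℝ) : ℝ :=
  ∫ x, (V x) ^ 2 ∂(confMeasure n w)

/-- Mean value zero w.r.t. `dv_g`. -/
def MeanZero (n : ℕ) (w : Eu n → ℝ) (V : Eu n → ℝ) : Prop :=
  ∫ x, V x ∂(confMeasure n w) = 0

/-- The second nonzero eigenvalue `λ₂(S^n, g)` of the Laplace–Beltrami operator of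
`g = w² g₀`, defined via the Courant–Fischer min-max characterization over two-dimensional
spaces of mean-zero test functions (restrictions of smooth ambient functions). -/
def lambda2 (n : ℕ) (w : Eu n → ℝ) : ℝ :=
  sInf { Λ : ℝ | ∃ V W : Eu n → ℝ, ContDiff ℝ (⊤ : ℕ∞) V ∧ ContDiff ℝ (⊤ : ℕ∞) W ∧
    MeanZero n w V ∧ MeanZero n w W ∧
    (∀ a b : ℝ, (∀ x ∈ sphSet n, a * V x + b * W x = 0) → a = 0 ∧ b = 0) ∧
    Λ = sSup { q : ℝ | ∃ a b : ℝ, ¬(a = 0 ∧ b = 0) ∧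
      q = dirichlet n w (fun x => a * V x + b * W x) /
          l2sq n w (fun x => a * V x + b * W x) } }

/-- The conformal transformation `d_ξ` of the closed unit ball. -/
def dMap {n : ℕ} (ξ : Eu n) (x : Eu n) : Eu n :=
  (1 + 2 * ⟪ξ, x⟫ + ‖x‖ ^ 2 * ‖ξ‖ ^ 2)⁻¹ •
    ((1 - ‖ξ‖ ^ 2) • x + (1 + 2 * ⟪ξ, x⟫ + ‖x‖ ^ 2) • ξ)

/-- The reflection `R_p(x) = x - 2(p·x)p`. -/
def Refl {n : ℕ} (p x : Eu n) : Eu n := x - (2 * ⟪p, x⟫) • p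

/-- The spherical cap `a_{r,p} = d_{rp}(a_{0,p})`. -/
def cap (n : ℕ) (r : ℝ) (p : Eu n) : Set (Eu n) :=
  dMap (r • p) '' {x ∈ sphSet n | 0 < ⟪p, x⟫}

/-- The conformal reflection `τ_{a_{r,p}} = d_{rp} ∘ R_p ∘ d_{-rp}`. -/
def tauMap {n : ℕ} (r : ℝ) (p : Eu n) : Eu n → Eu n :=
  dMap (r • p) ∘ Refl p ∘ dMap (-(r • p))

/-- The measure `μ_{a_{r,p}}`, equal to `dv_g + (τ_a)^* dv_g` on `a` and `0` on `a^*`. -/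
def capMeasure (n : ℕ) (w : Eu n → ℝ) (r : ℝ) (p : Eu n) : Measure (Eu n) :=
  (confMeasure n w + Measure.map (tauMap r p) (confMeasure n w)).restrict (cap n r p)

/-- `d_ξ` renormalizes the finite measure `μ`: `∫ X_s ∘ d_ξ dμ = 0` for all `s ∈ S^n`. -/
def Renormalizes {n : ℕ} (ξ : Eu n) (μ : Measure (Eu n)) : Prop :=
  ∀ s ∈ sphSet n, ∫ x, Xfun s (dMap ξ x) ∂μ = 0

/-- The quadratic form `Q(s) = ∫ X_s² dν` of a measure `ν`. -/
def Qform {n : ℕ} (ν : Measure (Eu n)) (s : Eu n) : ℝ := ∫ x, (⟪s, x⟫ : ℝ) ^ 2 ∂ν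

/-- The maximal eigenvalue of the quadratic form `Q`. -/
def maxEig (n : ℕ) (ν : Measure (Eu n)) : ℝ :=
  sSup { q : ℝ | ∃ s : Eu n, ‖s‖ = 1 ∧ q = Qform ν s }

/-- `ν` is simple with (unit) maximal direction `s₀`: the eigenspace of the maximal
eigenvalue of `Q` is the line spanned by `s₀`. -/
def IsMaxDir {n : ℕ} (ν : Measure (Eu n)) (s₀ : Eu n) : Prop :=
  ‖s₀‖ = 1 ∧ ∀ s : Eu n, Qform ν s = maxEig n ν * ‖s‖ ^ 2 ↔ ∃ c : ℝ, s = c • s₀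

/-- `ν` is multiple: the eigenspace of the maximal eigenvalue of `Q` has dimension ≥ 2. -/
def IsMultiple {n : ℕ} (ν : Measure (Eu n)) : Prop :=
  ∃ s t : Eu n, Qform ν s = maxEig n ν * ‖s‖ ^ 2 ∧ Qform ν t = maxEig n ν * ‖t‖ ^ 2 ∧
    LinearIndependent ℝ ![s, t]

/-- The test function `u_a^s` (for `a = a_{r,p}` with renormalization point `ξ`):
`X_s ∘ d_ξ` on `a` and `X_s ∘ d_ξ ∘ τ_a` on `a^*`. -/
def testFun (n : ℕ) (ξ : Eu n) (r : ℝ) (p : Eu n) (s : Eu n) (x : Eu n) : ℝ :=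
  if 0 < ⟪p, dMap (-(r • p)) x⟫ then Xfun s (dMap ξ x) else Xfun s (dMap ξ (tauMap r p x))

/-- The first coordinate vector `e₁ ∈ ℝ^{n+1}`. -/
def e1 (n : ℕ) : Eu n := EuclideanSpace.single 0 1

section multipleCap

variable {n : ℕ}

lemma mem_sphSet {x : Eu n} : x ∈ sphSet n ↔ ‖x‖ = 1 := by
  simp [sphSet]

/-- A smooth ambient map restricting to a conformal bijection of the unit sphere with conformal
factor `c`, whose derivative along the sphere is a similarity of the ambient space. -/
structure IsMoebius (f : Eu n → Eu n) (c : Eu n → ℝ) : Prop where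
  contDiff : ContDiff ℝ (⊤ : ℕ∞) f
  continuous_factor : Continuous c
  bijOn : BijOn f (sphSet n) (sphSet n)
  deriv : ∀ x ∈ sphSet n, 0 < c x ∧ ∃ R : Eu n ≃ₗᵢ[ℝ] Eu n,
    HasFDerivAt f (c x • (R : Eu n →L[ℝ] Eu n)) x ∧ (f x = R x ∨ f x = -R x)

lemma IsMoebius.comp {f g : Eu n → Eu n} {c d : Eu n → ℝ} (hg : IsMoebius g d)
    (hf : IsMoebius f c) : IsMoebius (g ∘ f) (fun x => d (f x) * c x) where
  contDiff := hg.contDiff.comp hf.contDiff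
  continuous_factor :=
    (hg.continuous_factor.comp hf.contDiff.continuous).mul hf.continuous_factor
  bijOn := hg.bijOn.comp hf.bijOn
  deriv x hx := by
    obtain ⟨hc, R, hR, hRx⟩ := hf.deriv x hx
    obtain ⟨hd, Q, hQ, hQx⟩ := hg.deriv (f x) (hf.bijOn.mapsTo hx)
    refine ⟨mul_pos hd hc, R.trans Q, ?_, ?_⟩
    · refine (hQ.comp x hR).congr_fderiv ?_
      ext1 v
      simp [smul_smul, mul_comm]
    · rcases hRx with h | h <;> rcases hQx with h' | h' <;> rw [Function.comp_apply, h', h] <;> simp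

lemma isMoebius_isometry (R : Eu n ≃ₗᵢ[ℝ] Eu n) : IsMoebius R (fun _ => 1) where
  contDiff := R.contDiff
  continuous_factor := continuous_const
  bijOn := by
    refine ⟨fun x hx => ?_, R.injective.injOn, fun y hy => ⟨R.symm y, ?_, by simp⟩⟩
    · rw [mem_sphSet] at *; simpa using hx
    · rw [mem_sphSet] at *; simpa using hy
  deriv x _ := by
    refine ⟨one_pos, R, ?_, Or.inl rfl⟩
    rw [one_smul]
    exact (R : Eu n →L[ℝ] Eu n).hasFDerivAt

/-- A globally smooth map agreeing to first order along the unit sphere with the conformal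
transformation `d_ξ`. -/
def mob (ξ x : Eu n) : Eu n :=
  ξ + ((1 - ‖ξ‖ ^ 2) / (‖x + ξ‖ ^ 2 + (‖x‖ ^ 2 - 1) ^ 2)) • (x + ξ)

/-- The conformal factor of `mob ξ` along the unit sphere. -/
def mobFactor (ξ x : Eu n) : ℝ :=
  (1 - ‖ξ‖ ^ 2) / (‖x + ξ‖ ^ 2 + (‖x‖ ^ 2 - 1) ^ 2)

lemma mob_denom_pos {ξ : Eu n} (hξ : ‖ξ‖ < 1) (x : Eu n) :
    0 < ‖x + ξ‖ ^ 2 + (‖x‖ ^ 2 - 1) ^ 2 := by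
  by_cases h : x + ξ = 0
  · have hx : ‖x‖ = ‖ξ‖ := by rw [eq_neg_of_add_eq_zero_left h, norm_neg]
    have : ‖x‖ ^ 2 - 1 < 0 := by rw [hx]; nlinarith [norm_nonneg ξ]
    have := pow_pos (neg_pos.2 this) 2
    rw [neg_sq] at this
    positivity
  · have := norm_pos_iff.2 h
    positivity

lemma one_sub_norm_sq_pos {ξ : Eu n} (hξ : ‖ξ‖ < 1) : 0 < 1 - ‖ξ‖ ^ 2 := by
  nlinarith [norm_nonneg ξ]

lemma contDiff_mobFactor {ξ : Eu n} (hξ : ‖ξ‖ < 1) : ContDiff ℝ (⊤ : ℕ∞) (mobFactor ξ) := by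
  unfold mobFactor
  refine contDiff_const.div ?_ fun x => (mob_denom_pos hξ x).ne'
  exact (((contDiff_id.add contDiff_const).norm_sq ℝ)).add
    (((contDiff_id.norm_sq ℝ).sub contDiff_const).pow 2)

lemma contDiff_mob {ξ : Eu n} (hξ : ‖ξ‖ < 1) : ContDiff ℝ (⊤ : ℕ∞) (mob ξ) :=
  contDiff_const.add ((contDiff_mobFactor hξ).smul (contDiff_id.add contDiff_const))

lemma norm_add_sq_of_mem {x : Eu n} (hx : x ∈ sphSet n) (ξ : Eu n) :
    ‖x + ξ‖ ^ 2 = 1 + 2 * ⟪ξ, x⟫ + ‖ξ‖ ^ 2 := by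
  rw [norm_add_sq_real, mem_sphSet.1 hx, real_inner_comm]; ring

lemma norm_add_sq_pos {ξ : Eu n} (hξ : ‖ξ‖ < 1) {x : Eu n} (hx : x ∈ sphSet n) :
    0 < ‖x + ξ‖ ^ 2 := by
  simpa [mem_sphSet.1 hx] using mob_denom_pos hξ x

lemma mob_of_mem {x : Eu n} (hx : x ∈ sphSet n) (ξ : Eu n) :
    mob ξ x = ξ + ((1 - ‖ξ‖ ^ 2) / ‖x + ξ‖ ^ 2) • (x + ξ) := by
  simp [mob, mem_sphSet.1 hx]

lemma dMap_eq_mob {ξ : Eu n} (hξ : ‖ξ‖ < 1) {x : Eu n} (hx : x ∈ sphSet n) :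
    dMap ξ x = mob ξ x := by
  have h := norm_add_sq_pos hξ hx
  rw [mob_of_mem hx, dMap, mem_sphSet.1 hx]
  rw [norm_add_sq_of_mem hx] at *
  have h' : 1 + 2 * ⟪ξ, x⟫ + ‖ξ‖ ^ 2 ≠ 0 := h.ne'
  have e : 1 + 2 * ⟪ξ, x⟫ + 1 ^ 2 * ‖ξ‖ ^ 2 = 1 + 2 * ⟪ξ, x⟫ + ‖ξ‖ ^ 2 := by ring
  rw [e]
  match_scalars <;> field_simp
  ring

lemma mob_mem {ξ : Eu n} (hξ : ‖ξ‖ < 1) {x : Eu n} (hx : x ∈ sphSet n) : mob ξ x ∈ sphSet n := by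
  have h := norm_add_sq_pos hξ hx
  have e := norm_add_sq_of_mem hx ξ
  have i : ⟪ξ, x + ξ⟫ = ⟪ξ, x⟫ + ‖ξ‖ ^ 2 := by rw [inner_add_right, real_inner_self_eq_norm_sq]
  rw [mem_sphSet, ← sq_eq_sq₀ (norm_nonneg _) one_pos.le, mob_of_mem hx, norm_add_sq_real,
    norm_smul, inner_smul_right, mul_pow, i, Real.norm_eq_abs, sq_abs]
  rw [e] at h ⊢
  have h' : 1 + 2 * ⟪ξ, x⟫ + ‖ξ‖ ^ 2 ≠ 0 := h.ne'
  field_simp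
  ring

lemma mob_neg_mob {ξ : Eu n} (hξ : ‖ξ‖ < 1) {x : Eu n} (hx : x ∈ sphSet n) :
    mob (-ξ) (mob ξ x) = x := by
  have h := norm_add_sq_pos hξ hx
  have h1 := one_sub_norm_sq_pos hξ
  rw [mob_of_mem (mob_mem hξ hx), mob_of_mem hx, norm_neg, add_neg_cancel_comm, norm_smul,
    mul_pow, Real.norm_eq_abs, sq_abs, smul_smul]
  have : (1 - ‖ξ‖ ^ 2) / (((1 - ‖ξ‖ ^ 2) / ‖x + ξ‖ ^ 2) ^ 2 * ‖x + ξ‖ ^ 2) *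
      ((1 - ‖ξ‖ ^ 2) / ‖x + ξ‖ ^ 2) = 1 := by
    generalize ‖x + ξ‖ ^ 2 = D at *
    field_simp
  rw [this]
  simp

lemma mob_mob_neg {ξ : Eu n} (hξ : ‖ξ‖ < 1) {x : Eu n} (hx : x ∈ sphSet n) :
    mob ξ (mob (-ξ) x) = x := by
  simpa using mob_neg_mob (ξ := -ξ) (by simpa using hξ) hx

lemma bijOn_mob {ξ : Eu n} (hξ : ‖ξ‖ < 1) : BijOn (mob ξ) (sphSet n) (sphSet n) :=
  have hξ' : ‖-ξ‖ < 1 := by simpa using hξ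
  BijOn.mk (fun _ hx => mob_mem hξ hx)
    (fun x hx y hy h => by rw [← mob_neg_mob hξ hx, h, mob_neg_mob hξ hy])
    (fun y hy => ⟨mob (-ξ) y, mob_mem hξ' hy, mob_mob_neg hξ hy⟩)

lemma isMoebius_mob {ξ : Eu n} (hξ : ‖ξ‖ < 1) : IsMoebius (mob ξ) (mobFactor ξ) where
  contDiff := contDiff_mob hξ
  continuous_factor := (contDiff_mobFactor hξ).continuous
  bijOn := bijOn_mob hξ
  deriv x hx := by
    have h1 := one_sub_norm_sq_pos hξ
    have hD := norm_add_sq_pos hξ hx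
    have hx1 := mem_sphSet.1 hx
    have hR : ∀ v, (ℝ ∙ (x + ξ))ᗮ.reflection v =
        v - (2 * (⟪x + ξ, v⟫ / ‖x + ξ‖ ^ 2)) • (x + ξ) := by
      intro v
      rw [Submodule.reflection_orthogonal_apply, Submodule.reflection_singleton_apply]
      simp only [RCLike.ofReal_real_eq_id, id]
      module
    refine ⟨by simpa [mobFactor, hx1] using div_pos h1 hD, (ℝ ∙ (x + ξ))ᗮ.reflection, ?_, ?_⟩
    · have A : HasFDerivAt (fun y : Eu n => y + ξ) (ContinuousLinearMap.id ℝ (Eu n)) x :=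
        (hasFDerivAt_id x).add_const ξ
      have N : HasFDerivAt (fun y : Eu n => ‖y‖ ^ 2) _ x := (hasFDerivAt_id x).norm_sq
      have D := A.norm_sq.add ((N.sub_const 1).pow 2)
      have I := ((hasDerivAt_inv (by simpa [hx1] using hD.ne')).comp_hasFDerivAt x D).const_mul
        (1 - ‖ξ‖ ^ 2)
      have F := (I.smul A).const_add ξ
      refine (F.congr_of_eventuallyEq (Eventually.of_forall fun y => ?_)).congr_fderiv ?_
      · simp [mob, div_eq_mul_inv]
      · ext1 v
        simp only [add_apply, smul_apply,
          ContinuousLinearMap.smulRight_apply, ContinuousLinearEquiv.coe_coe,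
          LinearIsometryEquiv.coe_toContinuousLinearEquiv, hR]
        simp only [hx1, mobFactor]
        generalize hw : ‖x + ξ‖ ^ 2 = D at *
        simp [hx1, hw]
        match_scalars <;> field_simp <;> simp [inner_add_left]
    · right
      rw [mob_of_mem hx, hR]
      have i : ⟪x + ξ, x⟫ = 1 + ⟪ξ, x⟫ := by
        rw [inner_add_left, real_inner_self_eq_norm_sq, hx1]; ring
      have e : (1 - ‖ξ‖ ^ 2) / ‖x + ξ‖ ^ 2 = 2 * (⟪x + ξ, x⟫ / ‖x + ξ‖ ^ 2) - 1 := by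
        rw [norm_add_sq_of_mem hx] at hD ⊢
        have hD' : 1 + 2 * ⟪ξ, x⟫ + ‖ξ‖ ^ 2 ≠ 0 := hD.ne'
        rw [i]
        field_simp
        ring
      rw [e]
      module

lemma smul_inv_norm_mem {x : Eu n} (hx : x ≠ 0) : ‖x‖⁻¹ • x ∈ sphSet n := by
  rw [mem_sphSet, norm_smul, norm_inv, norm_norm, inv_mul_cancel₀ (norm_ne_zero_iff.2 hx)]

lemma measurableSet_sphSet : MeasurableSet (sphSet n) := isClosed_sphere.measurableSet

instance : IsFiniteMeasure (sphMeasure n) := by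
  unfold sphMeasure; infer_instance

lemma ae_mem_sphSet : ∀ᵐ x ∂sphMeasure n, x ∈ sphSet n := by
  refine (ae_map_iff measurable_subtype_coe.aemeasurable measurableSet_sphSet).2 ?_
  exact Eventually.of_forall fun x => x.2

lemma sphMeasure_eq_map_radial : sphMeasure n = ((n + 1 : ℕ) : ℝ≥0∞) •
    Measure.map (fun x : Eu n => ‖x‖⁻¹ • x) (volume.restrict (ball 0 1 \ {0})) := by
  ext s hs
  have hm : Measurable fun x : Eu n => ‖x‖⁻¹ • x := by fun_prop
  rw [sphMeasure, Measure.map_apply measurable_subtype_coe hs,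
    Measure.toSphere_apply' _ (measurable_subtype_coe hs), Measure.smul_apply,
    Measure.map_apply hm hs, Measure.restrict_apply (hm hs), smul_eq_mul]
  congr 2
  · simp
  · ext x
    simp only [Subtype.image_preimage_coe, Set.mem_smul, mem_inter_iff, mem_preimage,
      Set.mem_sdiff, mem_ball_zero_iff, mem_singleton_iff]
    constructor
    · rintro ⟨t, ⟨ht, ht1⟩, y, ⟨hy, hys⟩, rfl⟩
      have hy1 : ‖y‖ = 1 := mem_sphSet.1 hy
      have hn : ‖t • y‖ = t := by rw [norm_smul, hy1, mul_one, Real.norm_of_nonneg ht.le]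
      rw [hn, smul_smul, inv_mul_cancel₀ ht.ne', one_smul]
      exact ⟨hys, ht1, norm_ne_zero_iff.1 (hn.trans_ne ht.ne')⟩
    · rintro ⟨hs, h1, h0⟩
      have := norm_pos_iff.2 h0
      refine ⟨‖x‖, ⟨this, h1⟩, ‖x‖⁻¹ • x, ⟨smul_inv_norm_mem h0, hs⟩, ?_⟩
      change ‖x‖ • ‖x‖⁻¹ • x = x
      rw [smul_smul, mul_inv_cancel₀ this.ne', one_smul]

lemma lintegral_sphMeasure {F : Eu n → ℝ≥0∞} (hF : Measurable F) :
    ∫⁻ x, F x ∂sphMeasure n =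
      ((n + 1 : ℕ) : ℝ≥0∞) * ∫⁻ x in ball 0 1 \ {0}, F (‖x‖⁻¹ • x) := by
  rw [sphMeasure_eq_map_radial, lintegral_smul_measure, lintegral_map hF (by fun_prop), smul_eq_mul]

/-- The positively homogeneous extension of degree one of a map of the sphere. -/
def homExt (f : Eu n → Eu n) (x : Eu n) : Eu n := ‖x‖ • f (‖x‖⁻¹ • x)

lemma abs_det_isometry (R : Eu n ≃ₗᵢ[ℝ] Eu n) : |LinearMap.det (R : Eu n →ₗ[ℝ] Eu n)| = 1 := by
  rw [← LinearMap.normDet_eq_abs_det]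
  exact R.toLinearIsometry.normDet_eq_one

lemma det_smul_add_rankOne {c k : ℝ} (hc : c ≠ 0) {u : Eu n} (hu : ‖u‖ = 1) :
    LinearMap.det (c • LinearMap.id + k • (innerₛₗ ℝ u).smulRight u : Eu n →ₗ[ℝ] Eu n) =
      c ^ n * (c + k) := by
  have : (c • LinearMap.id + k • (innerₛₗ ℝ u).smulRight u : Eu n →ₗ[ℝ] Eu n) =
      c • LinearMap.transvection ((k / c) • innerₛₗ ℝ u) u := by
    ext1 v
    simp [LinearMap.transvection.apply, smul_smul]
    field_simp
  rw [this, LinearMap.det_smul, LinearMap.transvection.det]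
  simp [hu]
  field_simp
  ring

lemma IsMoebius.hasFDerivAt_homExt {f : Eu n → Eu n} {c : Eu n → ℝ} (hf : IsMoebius f c)
    {x : Eu n} (hx : x ≠ 0) : ∃ L : Eu n →L[ℝ] Eu n, HasFDerivAt (homExt f) L x ∧
      |L.det| = c (‖x‖⁻¹ • x) ^ n := by
  have hu := smul_inv_norm_mem hx
  set u := ‖x‖⁻¹ • x with hu_def
  have hu1 := mem_sphSet.1 hu
  have hx0 := norm_pos_iff.2 hx
  obtain ⟨hc, R, hR, hRu⟩ := hf.deriv u hu
  have hN : HasFDerivAt (fun y : Eu n => ‖y‖) (innerSL ℝ u) x := by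
    have := (hasFDerivAt_id x).norm_sq.sqrt (by simpa using hx)
    refine (this.congr_of_eventuallyEq (Eventually.of_forall fun y => ?_)).congr_fderiv ?_
    · simp
    · ext1 v
      simp [hu_def]
      field_simp
  have hI := (hasDerivAt_inv hx0.ne').comp_hasFDerivAt x hN
  have hU := hI.smul (hasFDerivAt_id x)
  have hF : HasFDerivAt (homExt f) _ x := hN.smul (hR.comp x hU)
  obtain ⟨e, he, heu⟩ : ∃ e : ℝ, |e| = 1 ∧ f u = e • R u := by
    rcases hRu with h | h
    · exact ⟨1, by simp, by simp [h]⟩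
    · exact ⟨-1, by simp, by simp [h]⟩
  refine ⟨(R : Eu n →L[ℝ] Eu n) ∘L
    (c u • ContinuousLinearMap.id ℝ (Eu n) + (e - c u) • (innerSL ℝ u).smulRight u),
    hF.congr_fderiv ?_, ?_⟩
  · ext1 v
    have hxu : x = ‖x‖ • u := by rw [hu_def, smul_smul, mul_inv_cancel₀ hx0.ne', one_smul]
    have hRx : R x = ‖x‖ • R u := by
      conv_lhs => rw [hxu, map_smul]
    simp [← hu_def, heu, hRx, smul_smul]
    match_scalars <;> field_simp
    ring
  · have := det_smul_add_rankOne (k := e - c u) hc.ne' hu1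
    change |LinearMap.det ((R : Eu n →ₗ[ℝ] Eu n) ∘ₗ (c u • LinearMap.id +
      (e - c u) • (innerₛₗ ℝ u).smulRight u))| = _
    rw [LinearMap.det_comp, abs_mul, abs_det_isometry, this, one_mul, abs_mul, add_sub_cancel, he,
      mul_one, abs_of_pos (pow_pos hc n)]

lemma norm_homExt {f : Eu n → Eu n} {c : Eu n → ℝ} (hf : IsMoebius f c) (x : Eu n) :
    ‖homExt f x‖ = ‖x‖ := by
  by_cases hx : x = 0
  · simp [homExt, hx]
  · rw [homExt, norm_smul, mem_sphSet.1 (hf.bijOn.mapsTo (smul_inv_norm_mem hx))]; simp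

lemma radial_homExt {f : Eu n → Eu n} {c : Eu n → ℝ} (hf : IsMoebius f c) {x : Eu n}
    (hx : x ≠ 0) : ‖homExt f x‖⁻¹ • homExt f x = f (‖x‖⁻¹ • x) := by
  rw [norm_homExt hf, homExt, smul_smul, inv_mul_cancel₀ (norm_ne_zero_iff.2 hx), one_smul]

lemma bijOn_homExt {f : Eu n → Eu n} {c : Eu n → ℝ} (hf : IsMoebius f c) :
    BijOn (homExt f) (ball 0 1 \ {0}) (ball 0 1 \ {0}) := by
  have key : ∀ x : Eu n, x ∈ ball (0 : Eu n) 1 \ {0} ↔ ‖x‖ < 1 ∧ ‖x‖ ≠ 0 := by simp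
  refine ⟨fun x hx => ?_, fun x hx y hy h => ?_, fun y hy => ?_⟩
  · rw [key] at *; rwa [norm_homExt hf]
  · have hx0 : x ≠ 0 := hx.2
    have hy0 : y ≠ 0 := hy.2
    have hn : ‖x‖ = ‖y‖ := by rw [← norm_homExt hf, h, norm_homExt hf]
    have h1 := radial_homExt hf hx0
    rw [h, radial_homExt hf hy0] at h1
    have h2 := hf.bijOn.injOn (smul_inv_norm_mem hy0) (smul_inv_norm_mem hx0) h1
    rw [hn] at h2
    exact (smul_right_injective _ (inv_ne_zero (norm_ne_zero_iff.2 hy0)) h2).symm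
  · have hy0 : y ≠ 0 := hy.2
    obtain ⟨u, hu, huy⟩ := hf.bijOn.surjOn (smul_inv_norm_mem hy0)
    have hn : ‖(‖y‖ • u)‖ = ‖y‖ := by simp [norm_smul, mem_sphSet.1 hu]
    refine ⟨‖y‖ • u, ?_, ?_⟩
    · rw [key] at *; rwa [hn]
    · have h0 := norm_ne_zero_iff.2 hy0
      rw [homExt, hn, smul_smul, inv_mul_cancel₀ h0, one_smul, huy, smul_smul,
        mul_inv_cancel₀ h0, one_smul]

/-- Change of variables on the sphere under a Möbius transformation. -/
lemma IsMoebius.lintegral_comp {f : Eu n → Eu n} {c : Eu n → ℝ} (hf : IsMoebius f c)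
    {F : Eu n → ℝ≥0∞} (hF : Measurable F) :
    ∫⁻ x, ENNReal.ofReal (c x ^ n) * F (f x) ∂sphMeasure n = ∫⁻ x, F x ∂sphMeasure n := by
  have hfm : Measurable f := hf.contDiff.continuous.measurable
  have hcm : Measurable c := hf.continuous_factor.measurable
  have hS : MeasurableSet (ball (0 : Eu n) 1 \ {0}) :=
    measurableSet_ball.diff (measurableSet_singleton _)
  rw [lintegral_sphMeasure hF, lintegral_sphMeasure (by fun_prop)]
  congr 1
  choose! L hL hdet using fun (x : Eu n) (hx : x ≠ 0) => hf.hasFDerivAt_homExt hx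
  conv_rhs => rw [← (bijOn_homExt hf).image_eq]
  rw [lintegral_image_eq_lintegral_abs_det_fderiv_mul volume hS
    (fun x hx => (hL x hx.2).hasFDerivWithinAt) (bijOn_homExt hf).injOn]
  refine setLIntegral_congr_fun hS fun x hx => ?_
  rw [hdet x hx.2, radial_homExt hf hx.2]

lemma measurePreserving_isometry (R : Eu n ≃ₗᵢ[ℝ] Eu n) :
    MeasurePreserving R (sphMeasure n) (sphMeasure n) := by
  refine ⟨R.continuous.measurable, ?_⟩
  ext s hs
  have := (isMoebius_isometry R).lintegral_comp (F := s.indicator 1)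
    (measurable_one.indicator hs)
  rw [lintegral_indicator_one hs] at this
  rw [Measure.map_apply R.continuous.measurable hs, ← this,
    ← lintegral_indicator_one (R.continuous.measurable hs)]
  simp [indicator]

lemma integral_sphMeasure (g : Eu n → ℝ) :
    ∫ x, g x ∂sphMeasure n = ∫ x : sphere (0 : Eu n) 1, g x ∂(volume : Measure (Eu n)).toSphere :=
  (MeasurableEmbedding.subtype_coe measurableSet_sphSet).integral_map _

lemma integral_radial_mul (g : Eu n → ℝ) (h : ℝ → ℝ) :
    ∫ x : Eu n, g (‖x‖⁻¹ • x) * h ‖x‖ =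
      (∫ x, g x ∂sphMeasure n) * ∫ t in Ioi (0 : ℝ), t ^ n * h t := by
  let μ : Measure (Eu n) := volume
  calc
    ∫ x : Eu n, g (‖x‖⁻¹ • x) * h ‖x‖
      = ∫ x : ({(0)}ᶜ : Set (Eu n)), g (‖x.1‖⁻¹ • x.1) * h ‖x.1‖ ∂(μ.comap (↑)) := by
      rw [integral_subtype_comap (measurableSet_singleton _).compl
        fun x : Eu n => g (‖x‖⁻¹ • x) * h ‖x‖, restrict_compl_singleton]
    _ = ∫ x, g x.1 * h x.2 ∂μ.toSphere.prod (.volumeIoiPow (Module.finrank ℝ (Eu n) - 1)) := by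
      simpa using μ.measurePreserving_homeomorphUnitSphereProd.integral_comp
        (Homeomorph.measurableEmbedding _)
        (fun p : sphere (0 : Eu n) 1 × Ioi (0 : ℝ) => g p.1 * h p.2)
    _ = (∫ x : sphere (0 : Eu n) 1, g x ∂μ.toSphere) *
        ∫ t : Ioi (0 : ℝ), h t ∂.volumeIoiPow (Module.finrank ℝ (Eu n) - 1) :=
      integral_prod_mul (fun x : sphere (0 : Eu n) 1 => g x) (fun t : Ioi (0 : ℝ) => h t)
    _ = _ := by
      rw [integral_sphMeasure]
      congr 1
      simp only [Measure.volumeIoiPow, ENNReal.ofReal]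
      rw [integral_withDensity_eq_integral_smul,
        integral_subtype_comap measurableSet_Ioi
          fun a => Real.toNNReal (a ^ (Module.finrank ℝ (Eu n) - 1)) • h a,
        setIntegral_congr_fun measurableSet_Ioi fun x hx => ?_]
      · rw [NNReal.smul_def, Real.coe_toNNReal _ (pow_nonneg hx.out.le _)]
        simp
      · exact (measurable_subtype_coe.pow_const _).real_toNNReal

lemma integral_rpow_gaussian {q : ℝ} (hq : -1 < q) :
    ∫ t in Ioi (0 : ℝ), t ^ q * exp (-t ^ 2) = Gamma ((q + 1) / 2) / 2 := by
  have := integral_rpow_mul_exp_neg_rpow (p := 2) two_pos hq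
  simp only [Real.rpow_two] at this
  rw [this]; ring

lemma integral_pow_gaussian (k : ℕ) :
    ∫ t in Ioi (0 : ℝ), t ^ k * exp (-t ^ 2) = Gamma ((k + 1) / 2) / 2 := by
  have := integral_rpow_gaussian (q := k) (by linarith [(Nat.cast_nonneg k : (0 : ℝ) ≤ k)])
  simpa only [Real.rpow_natCast] using this

lemma integral_split_first (F : ℝ → ℝ → ℝ) :
    ∫ x : Eu n, F (x 0) (‖x‖ ^ 2 - x 0 ^ 2) =
      ∫ p : ℝ × EuclideanSpace ℝ (Fin n), F p.1 (‖p.2‖ ^ 2) := by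
  have h1 := (PiLp.volume_preserving_ofLp (Fin (n + 1))).integral_comp
    (MeasurableEquiv.toLp 2 (Fin (n + 1) → ℝ)).symm.measurableEmbedding
    (fun x : Fin (n + 1) → ℝ => F (x 0) (∑ i, x i ^ 2 - x 0 ^ 2))
  have h2 := (volume_preserving_piFinSuccAbove (fun _ : Fin (n + 1) => ℝ) 0).integral_comp
    (MeasurableEquiv.piFinSuccAbove (fun _ => ℝ) 0).measurableEmbedding
    (fun p : ℝ × (Fin n → ℝ) => F p.1 (∑ i, p.2 i ^ 2))
  have h3 := ((MeasurePreserving.id (volume : Measure ℝ)).prod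
    (PiLp.volume_preserving_ofLp (Fin n))).integral_comp
    ((MeasurableEquiv.refl ℝ).prodCongr
      (MeasurableEquiv.toLp 2 (Fin n → ℝ)).symm).measurableEmbedding
    (fun p : ℝ × (Fin n → ℝ) => F p.1 (∑ i, p.2 i ^ 2))
  calc _ = _ := ?_
    _ = _ := h1
    _ = _ := ?_
    _ = _ := h2
    _ = _ := h3.symm
    _ = _ := ?_
  · simp [EuclideanSpace.norm_sq_eq]
  · refine integral_congr_ae (Eventually.of_forall fun x => ?_)
    simp [Fin.sum_univ_succ, MeasurableEquiv.piFinSuccAbove, Fin.tail]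
  · refine integral_congr_ae (Eventually.of_forall fun x => ?_)
    simp [EuclideanSpace.norm_sq_eq]

lemma sigmaVol_eq : sigmaVol n = 2 * √π ^ (n + 1) / Gamma ((n + 1) / 2) := by
  have h : (0 : ℝ) < n + 1 := by positivity
  have hG : 0 < Gamma (((n : ℝ) + 1) / 2) := Gamma_pos_of_pos (by positivity)
  rw [sigmaVol, sphMeasure, Measure.map_apply measurable_subtype_coe .univ, preimage_univ,
    Measure.toSphere_apply_univ, EuclideanSpace.volume_ball]
  simp only [finrank_euclideanSpace, Fintype.card_fin, ENNReal.toReal_mul, ENNReal.toReal_natCast]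
  rw [ENNReal.ofReal_one, one_pow, ENNReal.toReal_one, one_mul,
    ENNReal.toReal_ofReal (by positivity)]
  push_cast
  rw [Gamma_add_one (by positivity)]
  field_simp

lemma integral_axis_eq_mul (hn : 1 ≤ n) :
    (∫ z, √(1 - ⟪e1 n, z⟫ ^ 2) ^ n ∂sphMeasure n) * (Gamma (n + 1 / 2) / 2) =
      √π * (2 * √π ^ n / Gamma (n / 2) * (Gamma n / 2)) := by
  have hA := integral_radial_mul (n := n) (fun z => √(1 - ⟪e1 n, z⟫ ^ 2) ^ n)
    (fun t => t ^ n * exp (-t ^ 2))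
  have hg : ∫ t in Ioi (0 : ℝ), t ^ n * (t ^ n * exp (-t ^ 2)) = Gamma (n + 1 / 2) / 2 := by
    simp only [← mul_assoc, ← pow_add]
    rw [integral_pow_gaussian]
    push_cast
    congr 2; ring
  rw [hg] at hA
  rw [← hA]
  have hB := integral_split_first (n := n) (fun a b => exp (-a ^ 2) * (√b ^ n * exp (-b)))
  have hC : ∫ x : Eu n, √(1 - ⟪e1 n, ‖x‖⁻¹ • x⟫ ^ 2) ^ n * (‖x‖ ^ n * exp (-‖x‖ ^ 2)) =
      ∫ x : Eu n, exp (-x 0 ^ 2) * (√(‖x‖ ^ 2 - x 0 ^ 2) ^ n * exp (-(‖x‖ ^ 2 - x 0 ^ 2))) := by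
    refine integral_congr_ae ?_
    filter_upwards [Measure.ae_ne volume (0 : Eu n)] with x hx
    have hx0 : 0 < ‖x‖ := norm_pos_iff.2 hx
    have e : ‖x‖ ^ 2 - x 0 ^ 2 = ‖x‖ ^ 2 * (1 - ⟪e1 n, ‖x‖⁻¹ • x⟫ ^ 2) := by
      simp [e1, inner_smul_right, EuclideanSpace.inner_single_left]
      field_simp
    have e2 : exp (-‖x‖ ^ 2) = exp (-x 0 ^ 2) * exp (-(‖x‖ ^ 2 - x 0 ^ 2)) := by
      rw [← exp_add]; congr 1; ring
    rw [e2, e, Real.sqrt_mul (sq_nonneg _), Real.sqrt_sq hx0.le, mul_pow]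
    ring
  rw [hC, hB]
  have hD := integral_prod_mul (μ := (volume : Measure ℝ))
    (ν := (volume : Measure (EuclideanSpace ℝ (Fin n)))) (fun a => exp (-a ^ 2))
    (fun y => √(‖y‖ ^ 2) ^ n * exp (-‖y‖ ^ 2))
  refine hD.trans ?_
  congr 1
  · simpa using integral_gaussian 1
  · obtain ⟨m, rfl⟩ : ∃ m, n = m + 1 := ⟨n - 1, by omega⟩
    have hE := integral_fun_norm_addHaar (volume : Measure (EuclideanSpace ℝ (Fin (m + 1))))
      (fun t => √(t ^ 2) ^ (m + 1) * exp (-t ^ 2))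
    rw [hE]
    have hF : ∫ t in Ioi (0 : ℝ), t ^ (Module.finrank ℝ (EuclideanSpace ℝ (Fin (m + 1))) - 1) •
        (√(t ^ 2) ^ (m + 1) * exp (-t ^ 2)) = Gamma ((m + 1 : ℕ) : ℝ) / 2 := by
      have : (((m + 1 : ℕ) : ℝ)) = ((2 * m + 1 : ℕ) + 1) / 2 := by push_cast; ring
      rw [this, ← integral_pow_gaussian]
      refine setIntegral_congr_fun measurableSet_Ioi fun t ht => ?_
      simp only [finrank_euclideanSpace, Fintype.card_fin, add_tsub_cancel_right, smul_eq_mul]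
      rw [Real.sqrt_sq (le_of_lt ht)]
      ring
    rw [hF, nsmul_eq_mul, smul_eq_mul, ← mul_assoc]
    congr 1
    have h0 : (0 : ℝ) < ((m + 1 : ℕ) : ℝ) / 2 := by positivity
    have hG := Gamma_pos_of_pos h0
    rw [Measure.real, EuclideanSpace.volume_ball]
    simp only [finrank_euclideanSpace, Fintype.card_fin, ENNReal.toReal_mul]
    rw [ENNReal.ofReal_one, one_pow, ENNReal.toReal_one, one_mul,
      Gamma_add_one h0.ne', ENNReal.toReal_ofReal (by positivity)]
    field_simp

/-- The `n`-energy of a coordinate function of the round sphere. -/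
lemma integral_energy_coordinate (hn : 1 ≤ n) {s : Eu n} (hs : ‖s‖ = 1) :
    ∫ z, √(1 - ⟪s, z⟫ ^ 2) ^ n ∂sphMeasure n = sigmaVol n *
      ((Gamma n * Gamma ((n + 1) / 2)) / (Gamma (n + 1 / 2) * Gamma (n / 2))) := by
  have he : ‖e1 n‖ = ‖s‖ := by simp [e1, hs]
  set R := (ℝ ∙ (e1 n - s))ᗮ.reflection
  have hR : R (e1 n) = s := Submodule.reflection_sub he
  have h1 : ∫ z, √(1 - ⟪s, z⟫ ^ 2) ^ n ∂sphMeasure n =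
      ∫ z, √(1 - ⟪e1 n, z⟫ ^ 2) ^ n ∂sphMeasure n := by
    have := (measurePreserving_isometry R).integral_comp
      R.toHomeomorph.measurableEmbedding (fun z => √(1 - ⟪s, z⟫ ^ 2) ^ n)
    rw [← this]
    simp [← hR]
  have hn0 : (0 : ℝ) < n := by positivity
  have g1 : 0 < Gamma ((n : ℝ) / 2) := Gamma_pos_of_pos (by positivity)
  have g2 : 0 < Gamma ((n : ℝ) + 1 / 2) := Gamma_pos_of_pos (by positivity)
  have g3 : 0 < Gamma (((n : ℝ) + 1) / 2) := Gamma_pos_of_pos (by positivity)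
  have h2 := integral_axis_eq_mul hn
  rw [h1, sigmaVol_eq]
  generalize (∫ z, √(1 - ⟪e1 n, z⟫ ^ 2) ^ n ∂sphMeasure n) = J at *
  have : J = √π * (2 * √π ^ n / Gamma (n / 2) * (Gamma n / 2)) / (Gamma (n + 1 / 2) / 2) := by
    rw [← h2]; field_simp
  rw [this]
  field_simp
  ring

lemma Kconst_eq (hn : 1 ≤ n) {s : Eu n} (hs : ‖s‖ = 1) :
    Kconst n * n * (2 * sigmaVol n) ^ ((2 : ℝ) / n) =
      (n + 1) * (2 * ∫ z, √(1 - ⟪s, z⟫ ^ 2) ^ n ∂sphMeasure n) ^ ((2 : ℝ) / n) := by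
  have hn0 : (0 : ℝ) < n := by positivity
  have g0 : 0 < Gamma (n : ℝ) := Gamma_pos_of_pos hn0
  have g1 : 0 < Gamma ((n : ℝ) / 2) := Gamma_pos_of_pos (by positivity)
  have g2 : 0 < Gamma ((n : ℝ) + 1 / 2) := Gamma_pos_of_pos (by positivity)
  have g3 : 0 < Gamma (((n : ℝ) + 1) / 2) := Gamma_pos_of_pos (by positivity)
  rw [integral_energy_coordinate hn hs, Kconst, ← mul_assoc, Real.mul_rpow (x := 2 * sigmaVol n)
    (mul_nonneg two_pos.le ENNReal.toReal_nonneg) (by positivity)]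
  field_simp

lemma sphMeasure_submodule {K : Submodule ℝ (Eu n)} (hK : K ≠ ⊤) : sphMeasure n K = 0 := by
  have hm : Measurable fun x : Eu n => ‖x‖⁻¹ • x := by fun_prop
  have hKm : MeasurableSet (K : Set (Eu n)) := K.closed_of_finiteDimensional.measurableSet
  rw [sphMeasure_eq_map_radial, Measure.smul_apply, Measure.map_apply hm hKm]
  have : (fun x : Eu n => ‖x‖⁻¹ • x) ⁻¹' K ⊆ K := by
    intro x hx
    by_cases h : x = 0
    · simp [h]
    · exact (K.smul_mem_iff (inv_ne_zero (norm_ne_zero_iff.2 h))).1 hx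
  rw [measure_mono_null this
    (Measure.restrict_le_self.absolutelyContinuous (Measure.addHaar_submodule volume K hK)),
    smul_zero]

lemma ae_inner_ne_zero {p : Eu n} (hp : p ≠ 0) : ∀ᵐ x ∂sphMeasure n, ⟪p, x⟫ ≠ 0 := by
  have : (ℝ ∙ p)ᗮ ≠ ⊤ := by
    rw [Ne, Submodule.orthogonal_eq_top_iff, Submodule.span_singleton_eq_bot]
    exact hp
  refine measure_mono_null (fun x hx => ?_) (sphMeasure_submodule this)
  simpa [Submodule.mem_orthogonal_singleton_iff_inner_right] using hx

lemma ae_inner_sq_lt (hn : 1 ≤ n) {s : Eu n} (hs : ‖s‖ = 1) :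
    ∀ᵐ x ∂sphMeasure n, ⟪s, x⟫ ^ 2 < 1 := by
  have : (ℝ ∙ s) ≠ ⊤ := by
    intro h
    have h1 := finrank_span_singleton (K := ℝ) (v := s) (by rintro rfl; simp at hs)
    rw [h, finrank_top] at h1
    simp at h1
    omega
  have h0 : ∀ᵐ x ∂sphMeasure n, x ∉ ℝ ∙ s :=
    measure_mono_null (fun x hx => by simpa using hx) (sphMeasure_submodule this)
  filter_upwards [ae_mem_sphSet, h0] with x hx hxs
  rw [mem_sphSet] at hx
  rw [sq_lt_one_iff_abs_lt_one]
  refine lt_of_le_of_ne (by simpa [hs, hx] using abs_real_inner_le_norm s x) fun h => hxs ?_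
  have : ‖⟪s, x⟫‖ = ‖s‖ * ‖x‖ := by simpa [hs, hx] using h
  rw [norm_inner_eq_norm_iff (by rintro rfl; simp at hs) (by rintro rfl; simp at hx)] at this
  obtain ⟨r, -, rfl⟩ := this
  exact Submodule.smul_mem _ _ (Submodule.mem_span_singleton_self s)

lemma IsMoebius.ae_comp {f : Eu n → Eu n} {c : Eu n → ℝ} (hf : IsMoebius f c)
    {P : Eu n → Prop} (hP : MeasurableSet {x | P x}) (h : ∀ᵐ x ∂sphMeasure n, P x) :
    ∀ᵐ x ∂sphMeasure n, P (f x) := by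
  have h1 := hf.lintegral_comp (F := {x | P x}ᶜ.indicator 1) (measurable_one.indicator hP.compl)
  rw [lintegral_indicator_one hP.compl, show sphMeasure n {x | P x}ᶜ = 0 from h] at h1
  have hm : Measurable fun x => ENNReal.ofReal (c x ^ n) * {x | P x}ᶜ.indicator 1 (f x) :=
    (hf.continuous_factor.measurable.pow_const n).ennreal_ofReal.mul
      ((measurable_one.indicator hP.compl).comp hf.contDiff.continuous.measurable)
  rw [lintegral_eq_zero_iff hm] at h1
  filter_upwards [h1, ae_mem_sphSet] with x hx hxs
  by_contra hPx
  have := pow_pos (hf.deriv x hxs).1 n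
  simp [hPx, this.not_ge] at hx

lemma sphMeasure_pos_of_isOpen {U : Set (Eu n)} (hU : IsOpen U) {x : Eu n} (hx : x ∈ sphSet n)
    (hxU : x ∈ U) : 0 < sphMeasure n U := by
  rw [sphMeasure, Measure.map_apply measurable_subtype_coe hU.measurableSet]
  exact (hU.preimage continuous_subtype_val).measure_pos _ ⟨⟨x, hx⟩, hxU⟩

/-- Hölder's inequality for the conformally weighted Dirichlet integrand. -/
lemma integral_pow_mul_sq_le {α : Type*} [MeasurableSpace α] {μ : Measure α} (hn : 2 ≤ n)
    {w f : α → ℝ} (hw : ∀ᵐ x ∂μ, 0 ≤ w x) (hf : ∀ᵐ x ∂μ, 0 ≤ f x)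
    (hwm : AEStronglyMeasurable w μ) (hfm : AEStronglyMeasurable f μ)
    (hwi : Integrable (fun x => w x ^ n) μ) (hfi : Integrable (fun x => f x ^ n) μ)
    (hw1 : ∫ x, w x ^ n ∂μ = 1) :
    ∫ x, w x ^ (n - 2) * f x ^ 2 ∂μ ≤ (∫ x, f x ^ n ∂μ) ^ ((2 : ℝ) / n) := by
  rcases hn.eq_or_lt with rfl | hn
  · simp
  have hn' : (2 : ℝ) < n := by exact_mod_cast hn
  have hc : ((n - 2 : ℕ) : ℝ) = n - 2 := by push_cast [hn.le]; ring
  have hpq : (n / (n - 2) : ℝ).HolderConjugate (n / 2) := by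
    rw [Real.holderConjugate_iff]
    constructor
    · rw [lt_div_iff₀ (by linarith)]; linarith
    · have : (n : ℝ) - 2 ≠ 0 := by linarith
      field_simp
      ring
  have e1 : ∀ a : ℝ, 0 ≤ a → (a ^ (n - 2)) ^ (n / (n - 2) : ℝ) = a ^ n := by
    intro a ha
    rw [← Real.rpow_natCast a (n - 2), ← Real.rpow_mul ha, hc, mul_div_cancel₀ _ (by linarith),
      Real.rpow_natCast]
  have e2 : ∀ a : ℝ, 0 ≤ a → (a ^ 2) ^ (n / 2 : ℝ) = a ^ n := by
    intro a ha
    rw [← Real.rpow_natCast a 2, ← Real.rpow_mul ha, Nat.cast_ofNat, mul_div_cancel₀ _ two_ne_zero,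
      Real.rpow_natCast]
  have key : ∀ {g : α → ℝ} {k : ℕ} {b : ℝ}, 1 < b → (∀ᵐ x ∂μ, 0 ≤ g x) →
      AEStronglyMeasurable g μ → Integrable (fun x => g x ^ n) μ →
      (∀ a : ℝ, 0 ≤ a → (a ^ k) ^ b = a ^ n) →
      MemLp (fun x => g x ^ k) (ENNReal.ofReal b) μ := by
    intro g k b hb hg hgm hgi h
    refine (integrable_norm_rpow_iff (f := fun x => g x ^ k) (hgm.pow k) (by simp; linarith)
      ENNReal.ofReal_ne_top).1 ?_
    rw [ENNReal.toReal_ofReal (by linarith)]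
    refine hgi.congr ?_
    filter_upwards [hg] with x hx
    rw [Real.norm_of_nonneg (by positivity), h _ hx]
  have H := integral_mul_le_Lp_mul_Lq_of_nonneg hpq (μ := μ) (f := fun x => w x ^ (n - 2))
    (g := fun x => f x ^ 2) (by filter_upwards [hw] with x hx; positivity)
    (by filter_upwards with x; positivity)
    (key hpq.lt hw hwm hwi e1) (key hpq.symm.lt hf hfm hfi e2)
  refine H.trans_eq ?_
  have i1 : ∫ x, (w x ^ (n - 2)) ^ (n / (n - 2) : ℝ) ∂μ = 1 := by
    rw [← hw1]
    refine integral_congr_ae ?_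
    filter_upwards [hw] with x hx using e1 _ hx
  have i2 : ∫ x, (f x ^ 2) ^ (n / 2 : ℝ) ∂μ = ∫ x, f x ^ n ∂μ := by
    refine integral_congr_ae ?_
    filter_upwards [hf] with x hx using e2 _ hx
  rw [i1, i2, Real.one_rpow, one_mul, one_div_div]

lemma abs_norm_sq_sub_norm_sq_le {F : Type*} [NormedAddCommGroup F] [NormedSpace ℝ F]
    (A B : Eu n →L[ℝ] F) (s : Eu n) :
    |‖A s‖ ^ 2 - ‖B s‖ ^ 2| ≤ ‖A - B‖ * (‖A‖ + ‖B‖) * ‖s‖ ^ 2 := by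
  have h1 : |‖A s‖ - ‖B s‖| ≤ ‖A - B‖ * ‖s‖ :=
    (abs_norm_sub_norm_le _ _).trans (by simpa using (A - B).le_opNorm s)
  have h2 : |‖A s‖ + ‖B s‖| ≤ (‖A‖ + ‖B‖) * ‖s‖ := by
    rw [abs_of_nonneg (by positivity), add_mul]
    exact add_le_add (A.le_opNorm s) (B.le_opNorm s)
  calc _ = |‖A s‖ - ‖B s‖| * |‖A s‖ + ‖B s‖| := by rw [← abs_mul]; congr 1; ring
    _ ≤ (‖A - B‖ * ‖s‖) * ((‖A‖ + ‖B‖) * ‖s‖) := by gcongr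
    _ = _ := by ring

/-- Bounded almost everywhere convergence of operators implies uniform convergence of the
associated integrated quadratic forms. -/
lemma exists_tendsto_quadratic_bound {F : Type*} [NormedAddCommGroup F] [NormedSpace ℝ F]
    {μ : Measure (Eu n)} {ω : Eu n → ℝ} (hω : Integrable ω μ)
    {B : ℕ → Eu n → Eu n →L[ℝ] F} {B₀ : Eu n → Eu n →L[ℝ] F} {C : ℝ}
    (hB : ∀ k, AEStronglyMeasurable (B k) μ) (hC : ∀ᵐ x ∂μ, ∀ k, ‖B k x‖ ≤ C)
    (hlim : ∀ᵐ x ∂μ, Tendsto (fun k => B k x) atTop (𝓝 (B₀ x))) :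
    ∃ η : ℕ → ℝ, Tendsto η atTop (𝓝 0) ∧ ∀ k s,
      |∫ x, ω x * ‖B k x s‖ ^ 2 ∂μ - ∫ x, ω x * ‖B₀ x s‖ ^ 2 ∂μ| ≤ η k * ‖s‖ ^ 2 := by
  have hB₀ : AEStronglyMeasurable B₀ μ := aestronglyMeasurable_of_tendsto_ae atTop hB hlim
  have hC₀ : ∀ᵐ x ∂μ, ‖B₀ x‖ ≤ C := by
    filter_upwards [hC, hlim] with x hx hl
    exact le_of_tendsto hl.norm (Eventually.of_forall hx)
  have hint : ∀ A : Eu n → Eu n →L[ℝ] F, AEStronglyMeasurable A μ → (∀ᵐ x ∂μ, ‖A x‖ ≤ C) →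
      ∀ s, Integrable (fun x => ω x * ‖A x s‖ ^ 2) μ := by
    intro A hA hAC s
    refine hω.mul_bdd (c := (C * ‖s‖) ^ 2) ?_ ?_
    · have : AEStronglyMeasurable (fun x => A x s) μ :=
        (ContinuousLinearMap.apply ℝ F s).continuous.comp_aestronglyMeasurable hA
      exact this.norm.pow 2
    · filter_upwards [hAC] with x hx
      rw [Real.norm_of_nonneg (by positivity)]
      gcongr
      exact ((A x).le_opNorm s).trans (by gcongr)
  have hbd : ∀ k, ∀ᵐ x ∂μ, ‖‖ω x‖ * (‖B k x - B₀ x‖ * (‖B k x‖ + ‖B₀ x‖))‖ ≤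
      ‖ω x‖ * ((C + C) * (C + C)) := by
    intro k
    filter_upwards [hC, hC₀] with x hx hx0
    have := (norm_nonneg _).trans hx0
    rw [Real.norm_of_nonneg (by positivity)]
    gcongr
    · exact (norm_sub_le _ _).trans (add_le_add (hx k) hx0)
    · exact hx k
  have hms : ∀ k, AEStronglyMeasurable
      (fun x => ‖ω x‖ * (‖B k x - B₀ x‖ * (‖B k x‖ + ‖B₀ x‖))) μ := fun k =>
    hω.1.norm.mul (((hB k).sub hB₀).norm.mul ((hB k).norm.add hB₀.norm))
  refine ⟨fun k => ∫ x, ‖ω x‖ * (‖B k x - B₀ x‖ * (‖B k x‖ + ‖B₀ x‖)) ∂μ, ?_, fun k s => ?_⟩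
  · have := tendsto_integral_of_dominated_convergence (μ := μ) (f := fun _ => 0)
      (fun x => ‖ω x‖ * ((C + C) * (C + C))) hms (hω.norm.mul_const _) hbd ?_
    · simpa using this
    · filter_upwards [hlim] with x hx
      have h1 : Tendsto (fun k => ‖B k x - B₀ x‖) atTop (𝓝 0) := by
        simpa using (hx.sub_const (B₀ x)).norm
      simpa using (h1.mul (hx.norm.add_const ‖B₀ x‖)).const_mul ‖ω x‖
  · rw [← integral_sub (hint _ (hB k) (hC.mono fun x hx => hx k) s) (hint _ hB₀ hC₀ s),
      ← Real.norm_eq_abs, ← integral_mul_const]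
    refine norm_integral_le_of_norm_le
      (((hω.norm.mul_const _).mono' (hms k) (hbd k)).mul_const _) ?_
    refine Eventually.of_forall fun x => ?_
    rw [← mul_sub, norm_mul, mul_assoc]
    gcongr
    exact abs_norm_sq_sub_norm_sq_le _ _ _

lemma exists_max_partial_energy (hn : 1 ≤ n) {U : Set (Eu n)} (hU : MeasurableSet U)
    (hUc : 0 < sphMeasure n Uᶜ) : ∃ s₀ : Eu n, ‖s₀‖ = 1 ∧
      (∀ s : Eu n, ‖s‖ = 1 → ∫ z in U, √(1 - ⟪s, z⟫ ^ 2) ^ n ∂sphMeasure n ≤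
        ∫ z in U, √(1 - ⟪s₀, z⟫ ^ 2) ^ n ∂sphMeasure n) ∧
      ∫ z in U, √(1 - ⟪s₀, z⟫ ^ 2) ^ n ∂sphMeasure n <
        ∫ z, √(1 - ⟪s₀, z⟫ ^ 2) ^ n ∂sphMeasure n := by
  have hcont : ∀ s : Eu n, Continuous fun z => √(1 - ⟪s, z⟫ ^ 2) ^ n := fun s => by fun_prop
  have hle : ∀ s z : Eu n, ‖√(1 - ⟪s, z⟫ ^ 2) ^ n‖ ≤ 1 := by
    intro s z
    rw [Real.norm_of_nonneg (by positivity)]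
    exact pow_le_one₀ (Real.sqrt_nonneg _) (Real.sqrt_le_one.2 (by nlinarith [sq_nonneg ⟪s, z⟫]))
  have hint : ∀ s, Integrable (fun z => √(1 - ⟪s, z⟫ ^ 2) ^ n) (sphMeasure n) := fun s =>
    Integrable.of_bound (hcont s).aestronglyMeasurable 1 (Eventually.of_forall (hle s))
  have hJ : Continuous fun s : Eu n => ∫ z in U, √(1 - ⟪s, z⟫ ^ 2) ^ n ∂sphMeasure n := by
    refine continuous_of_dominated (bound := fun _ => 1) (fun s => (hcont s).aestronglyMeasurable)
      (fun s => Eventually.of_forall (hle s)) (integrable_const _)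
      (Eventually.of_forall fun z => ?_)
    fun_prop
  obtain ⟨s₀, hs₀, hmax⟩ := (isCompact_sphere (0 : Eu n) 1).exists_isMaxOn
    ⟨e1 n, by simp [e1]⟩ hJ.continuousOn
  have hs₀ : ‖s₀‖ = 1 := by simpa using hs₀
  refine ⟨s₀, hs₀, fun s hs => hmax (by simpa using hs), ?_⟩
  rw [← integral_add_compl hU (hint s₀), lt_add_iff_pos_right,
    setIntegral_pos_iff_support_of_nonneg_ae (Eventually.of_forall fun z => by positivity)
    (hint s₀).integrableOn]
  refine hUc.trans_le (measure_mono_ae ?_)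
  filter_upwards [ae_inner_sq_lt hn hs₀] with z hz hzU
  exact ⟨(pow_pos (Real.sqrt_pos.2 (sub_pos.2 hz)) n).ne', hzU⟩

/-- A regularised folding of space across the hyperplane orthogonal to `p`. -/
def fold (p : Eu n) (ε : ℝ) (y : Eu n) : Eu n := y + (√(⟪p, y⟫ ^ 2 + ε ^ 2) - ⟪p, y⟫) • p

/-- The derivative of `fold p ε` at a point with `p`-coordinate `t`. -/
def foldDeriv (p : Eu n) (ε t : ℝ) : Eu n →L[ℝ] Eu n :=
  ContinuousLinearMap.id ℝ (Eu n) + (t / √(t ^ 2 + ε ^ 2) - 1) • (innerSL ℝ p).smulRight p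

lemma fold_radicand_pos {ε : ℝ} (hε : ε ≠ 0) (t : ℝ) : 0 < t ^ 2 + ε ^ 2 := by positivity

lemma contDiff_fold (p : Eu n) {ε : ℝ} (hε : ε ≠ 0) : ContDiff ℝ (⊤ : ℕ∞) (fold p ε) := by
  have h : ContDiff ℝ (⊤ : ℕ∞) fun y : Eu n => ⟪p, y⟫ := contDiff_const.inner ℝ contDiff_id
  exact contDiff_id.add ((((h.pow 2).add contDiff_const).sqrt
    fun y => (fold_radicand_pos hε _).ne').sub h |>.smul contDiff_const)

lemma hasFDerivAt_fold (p : Eu n) {ε : ℝ} (hε : ε ≠ 0) (y : Eu n) :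
    HasFDerivAt (fold p ε) (foldDeriv p ε ⟪p, y⟫) y := by
  have h : HasFDerivAt (fun y : Eu n => ⟪p, y⟫) (innerSL ℝ p) y := (innerSL ℝ p).hasFDerivAt
  have hpos := fold_radicand_pos hε ⟪p, y⟫
  refine ((hasFDerivAt_id y).add
    ((((h.pow 2).add_const (ε ^ 2)).sqrt hpos.ne').sub h |>.smul_const p)).congr_fderiv ?_
  ext1 v
  have := Real.sqrt_pos.2 hpos
  simp only [foldDeriv, add_apply, smul_apply, sub_apply, ContinuousLinearMap.smulRight_apply,
    ContinuousLinearMap.id_apply, innerSL_apply_apply, smul_smul, smul_eq_mul]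
  congr 2
  field_simp
  simp
  ring

lemma continuous_fold_left (p y : Eu n) : Continuous fun ε => fold p ε y := by
  unfold fold; fun_prop

lemma continuous_fold (p : Eu n) (ε : ℝ) : Continuous (fold p ε) := by
  unfold fold; fun_prop

lemma reflection_orthogonal_unit {p : Eu n} (hp : ‖p‖ = 1) (y : Eu n) :
    (ℝ ∙ p)ᗮ.reflection y = Refl p y := by
  rw [Submodule.reflection_orthogonal_apply, Submodule.reflection_singleton_apply, Refl]
  simp only [RCLike.ofReal_real_eq_id, id, hp]
  module

lemma fold_zero_of_nonneg {p y : Eu n} (h : 0 ≤ ⟪p, y⟫) : fold p 0 y = y := by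
  simp [fold, Real.sqrt_sq h]

lemma fold_zero_of_nonpos {p y : Eu n} (h : ⟪p, y⟫ ≤ 0) : fold p 0 y = Refl p y := by
  simp only [fold, Refl, zero_pow two_ne_zero, add_zero, Real.sqrt_sq_eq_abs, abs_of_nonpos h]
  module

lemma fold_zero_mem {p y : Eu n} (hp : ‖p‖ = 1) (hy : y ∈ sphSet n) : fold p 0 y ∈ sphSet n := by
  rcases le_total 0 ⟪p, y⟫ with h | h
  · rwa [fold_zero_of_nonneg h]
  · rw [fold_zero_of_nonpos h, ← reflection_orthogonal_unit hp, mem_sphSet,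
      LinearIsometryEquiv.norm_map]
    exact mem_sphSet.1 hy

lemma norm_fold_le {p : Eu n} (hp : ‖p‖ = 1) {ε : ℝ} (hε : |ε| ≤ 1) {y : Eu n} (hy : y ∈ sphSet n) :
    ‖fold p ε y‖ ≤ 4 := by
  rw [mem_sphSet] at hy
  have h1 : |⟪p, y⟫| ≤ 1 := by simpa [hp, hy] using abs_real_inner_le_norm p y
  have h2 : √(⟪p, y⟫ ^ 2 + ε ^ 2) ≤ 2 := by
    rw [Real.sqrt_le_left two_pos.le]
    nlinarith [sq_le_one_iff_abs_le_one _ |>.2 h1, sq_le_one_iff_abs_le_one _ |>.2 hε]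
  have h3 : |√(⟪p, y⟫ ^ 2 + ε ^ 2) - ⟪p, y⟫| ≤ 3 := by
    rw [abs_le] at *
    constructor <;> linarith [Real.sqrt_nonneg (⟪p, y⟫ ^ 2 + ε ^ 2)]
  refine (norm_add_le _ _).trans ?_
  rw [norm_smul, hy, hp, Real.norm_eq_abs]
  linarith

lemma foldDeriv_zero_of_pos (p : Eu n) {t : ℝ} (ht : 0 < t) :
    foldDeriv p 0 t = ContinuousLinearMap.id ℝ (Eu n) := by
  simp [foldDeriv, Real.sqrt_sq ht.le, ht.ne']

lemma foldDeriv_zero_of_neg {p : Eu n} (hp : ‖p‖ = 1) {t : ℝ} (ht : t < 0) :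
    foldDeriv p 0 t = ((ℝ ∙ p)ᗮ.reflection : Eu n →L[ℝ] Eu n) := by
  ext1 v
  have : t / √(t ^ 2) = -1 := by
    rw [Real.sqrt_sq_eq_abs, abs_of_neg ht, div_neg, div_self ht.ne]
  have e : ((ℝ ∙ p)ᗮ.reflection : Eu n →L[ℝ] Eu n) v = Refl p v := reflection_orthogonal_unit hp v
  rw [e]
  simp only [foldDeriv, zero_pow two_ne_zero, add_zero, this, Refl, add_apply, smul_apply,
    ContinuousLinearMap.smulRight_apply, ContinuousLinearMap.id_apply, innerSL_apply_apply]
  module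

lemma norm_foldDeriv_le {p : Eu n} (hp : ‖p‖ = 1) (ε t : ℝ) : ‖foldDeriv p ε t‖ ≤ 3 := by
  have h1 : |t / √(t ^ 2 + ε ^ 2)| ≤ 1 := by
    rw [abs_div, abs_of_nonneg (Real.sqrt_nonneg _)]
    refine div_le_one_of_le₀ (Real.le_sqrt_of_sq_le ?_) (Real.sqrt_nonneg _)
    rw [sq_abs]
    exact le_add_of_nonneg_right (sq_nonneg _)
  have h2 : |t / √(t ^ 2 + ε ^ 2) - 1| ≤ 2 := by
    rw [abs_le] at *
    constructor <;> linarith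
  refine (norm_add_le _ _).trans ?_
  rw [norm_smul, ContinuousLinearMap.norm_smulRight_apply, innerSL_apply_norm, hp, Real.norm_eq_abs]
  linarith [ContinuousLinearMap.norm_id_le (𝕜 := ℝ) (E := Eu n)]

lemma continuous_foldDeriv (p : Eu n) {ε : ℝ} (hε : ε ≠ 0) : Continuous (foldDeriv p ε) := by
  unfold foldDeriv
  have : ∀ t : ℝ, √(t ^ 2 + ε ^ 2) ≠ 0 := fun t => (Real.sqrt_pos.2 (fold_radicand_pos hε t)).ne'
  fun_prop (disch := assumption)

lemma continuousAt_foldDeriv_left (p : Eu n) {t : ℝ} (ht : t ≠ 0) :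
    ContinuousAt (fun ε => foldDeriv p ε t) 0 := by
  unfold foldDeriv
  have : √(t ^ 2 + 0 ^ 2) ≠ 0 := by simpa [Real.sqrt_sq_eq_abs] using ht
  fun_prop (disch := assumption)

/-- The map `s ↦ ∇_{S^n} (s · T) (x)`, where `T` is a map with derivative `A` at `x`. -/
def tangentOp (A : Eu n →L[ℝ] Eu n) (x : Eu n) : Eu n →L[ℝ] Eu n :=
  (ContinuousLinearMap.id ℝ (Eu n) - (innerSL ℝ x).smulRight x).comp (ContinuousLinearMap.adjoint A)

lemma tangentOp_apply (A : Eu n →L[ℝ] Eu n) (x s : Eu n) : tangentOp A x s =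
    ContinuousLinearMap.adjoint A s - ⟪x, ContinuousLinearMap.adjoint A s⟫ • x := by
  simp [tangentOp]

lemma ContinuousAt.tangentOp {X : Type*} [TopologicalSpace X] {A : X → Eu n →L[ℝ] Eu n}
    {v : X → Eu n} {a : X} (hA : ContinuousAt A a) (hv : ContinuousAt v a) :
    ContinuousAt (fun a => tangentOp (A a) (v a)) a := by
  have h1 : ContinuousAt (fun a => ContinuousLinearMap.adjoint (A a)) a :=
    ContinuousLinearMap.adjoint.continuous.continuousAt.comp hA
  have h2 : Continuous fun x : Eu n => (innerSL ℝ x).smulRight x :=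
    (ContinuousLinearMap.smulRightL ℝ (Eu n) (Eu n)).continuous₂.comp
      ((innerSL ℝ).continuous.prodMk continuous_id)
  exact (continuousAt_const.sub (h2.continuousAt.comp hv)).clm_comp h1

lemma norm_tangentOp_le (A : Eu n →L[ℝ] Eu n) {x : Eu n} (hx : x ∈ sphSet n) :
    ‖tangentOp A x‖ ≤ 2 * ‖A‖ := by
  refine (ContinuousLinearMap.opNorm_comp_le _ _).trans ?_
  rw [LinearIsometryEquiv.norm_map]
  gcongr
  refine (norm_sub_le _ _).trans ?_
  rw [ContinuousLinearMap.norm_smulRight_apply, innerSL_apply_norm, mem_sphSet.1 hx]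
  linarith [ContinuousLinearMap.norm_id_le (𝕜 := ℝ) (E := Eu n)]

lemma gradS_inner {T : Eu n → Eu n} {A : Eu n →L[ℝ] Eu n} {x : Eu n} (hT : HasFDerivAt T A x)
    (s : Eu n) (c : ℝ) : gradS (fun y => ⟪s, T y⟫ - c) x = tangentOp A x s := by
  have h : HasGradientAt (fun y => ⟪s, T y⟫ - c) (ContinuousLinearMap.adjoint A s) x := by
    rw [hasGradientAt_iff_hasFDerivAt]
    refine ((((innerSL ℝ s).hasFDerivAt).comp x hT).sub_const c).congr_fderiv ?_
    ext1 v
    simp [ContinuousLinearMap.adjoint_inner_left]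
  rw [gradS, h.gradient, tangentOp_apply, real_inner_comm]

lemma norm_tangentOp_similarity {c : ℝ} {R : Eu n ≃ₗᵢ[ℝ] Eu n} {x z : Eu n} (hx : x ∈ sphSet n)
    (hz : z = R x ∨ z = -R x) (s : Eu n) :
    ‖tangentOp (c • (R : Eu n →L[ℝ] Eu n)) x s‖ ^ 2 = c ^ 2 * (‖s‖ ^ 2 - ⟪s, z⟫ ^ 2) := by
  have hx1 := mem_sphSet.1 hx
  have hadj : ContinuousLinearMap.adjoint (c • (R : Eu n →L[ℝ] Eu n)) s = c • R.symm s := by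
    refine ext_inner_right ℝ fun v => ?_
    rw [ContinuousLinearMap.adjoint_inner_left, smul_apply, inner_smul_right, inner_smul_left,
      ← R.symm.inner_map_map s]
    simp
  have hi : ⟪x, R.symm s⟫ ^ 2 = ⟪s, z⟫ ^ 2 := by
    have : ⟪x, R.symm s⟫ = ⟪s, R x⟫ := by
      rw [← R.inner_map_map, R.apply_symm_apply, real_inner_comm]
    rcases hz with rfl | rfl <;> simp [this]
  rw [tangentOp_apply, hadj, inner_smul_right, mul_smul, ← smul_sub, norm_smul, mul_pow,
    norm_sub_sq_real, inner_smul_right, norm_smul, R.symm.norm_map, hx1, real_inner_comm x, mul_one,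
    Real.norm_eq_abs, Real.norm_eq_abs, sq_abs, sq_abs, ← hi]
  ring

/-- The tangential derivative of the (regularised) folded conformal map `Φ ∘ fold p ε ∘ Ψ`. -/
def foldOp (Φ Ψ : Eu n → Eu n) (p : Eu n) (ε : ℝ) (x : Eu n) : Eu n →L[ℝ] Eu n :=
  tangentOp ((fderiv ℝ Φ (fold p ε (Ψ x))).comp
    ((foldDeriv p ε ⟪p, Ψ x⟫).comp (fderiv ℝ Ψ x))) x

section foldOp

variable {Φ Ψ : Eu n → Eu n} {cΦ cΨ : Eu n → ℝ} {p : Eu n}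

lemma gradS_fold (hΦ : IsMoebius Φ cΦ) (hΨ : IsMoebius Ψ cΨ) {ε : ℝ} (hε : ε ≠ 0) (x s : Eu n)
    (c : ℝ) : gradS (fun y => ⟪s, Φ (fold p ε (Ψ y))⟫ - c) x = foldOp Φ Ψ p ε x s := by
  have h1 := (hΦ.contDiff.differentiable (by simp) (fold p ε (Ψ x))).hasFDerivAt
  have h2 := (hΨ.contDiff.differentiable (by simp) x).hasFDerivAt
  exact gradS_inner (h1.comp x ((hasFDerivAt_fold p hε (Ψ x)).comp x h2)) s c

lemma continuous_foldOp (hΦ : IsMoebius Φ cΦ) (hΨ : IsMoebius Ψ cΨ) {ε : ℝ} (hε : ε ≠ 0) :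
    Continuous (foldOp Φ Ψ p ε) := by
  have hΨc := hΨ.contDiff.continuous
  have h1 : Continuous fun x => fderiv ℝ Φ (fold p ε (Ψ x)) :=
    (hΦ.contDiff.continuous_fderiv (by simp)).comp ((continuous_fold p ε).comp hΨc)
  have h2 : Continuous (fderiv ℝ Ψ) := hΨ.contDiff.continuous_fderiv (by simp)
  have h3 : Continuous fun x => foldDeriv p ε ⟪p, Ψ x⟫ :=
    (continuous_foldDeriv p hε).comp (continuous_const.inner hΨc)
  exact continuous_iff_continuousAt.2 fun x =>
    (h1.clm_comp (h3.clm_comp h2)).continuousAt.tangentOp continuousAt_id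

lemma exists_norm_foldOp_le (hΦ : IsMoebius Φ cΦ) (hΨ : IsMoebius Ψ cΨ) (hp : ‖p‖ = 1) :
    ∃ C : ℝ, ∀ ε, |ε| ≤ 1 → ∀ x ∈ sphSet n, ‖foldOp Φ Ψ p ε x‖ ≤ C := by
  have h1 : Continuous (fderiv ℝ Φ) := hΦ.contDiff.continuous_fderiv (by simp)
  have h2 : Continuous (fderiv ℝ Ψ) := hΨ.contDiff.continuous_fderiv (by simp)
  obtain ⟨C₁, hC₁⟩ :=
    (isCompact_closedBall (0 : Eu n) 4).exists_bound_of_continuousOn h1.continuousOn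
  obtain ⟨C₂, hC₂⟩ := (isCompact_sphere (0 : Eu n) 1).exists_bound_of_continuousOn h2.continuousOn
  refine ⟨2 * (C₁ * (3 * C₂)), fun ε hε x hx => (norm_tangentOp_le _ hx).trans ?_⟩
  have b1 := hC₁ (fold p ε (Ψ x))
    (by simpa using norm_fold_le hp hε (hΨ.bijOn.mapsTo hx))
  have b2 := hC₂ x hx
  have := (norm_nonneg _).trans b1
  gcongr
  refine (ContinuousLinearMap.opNorm_comp_le _ _).trans ?_
  gcongr
  refine (ContinuousLinearMap.opNorm_comp_le _ _).trans ?_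
  gcongr
  exact norm_foldDeriv_le hp _ _

lemma tendsto_foldOp (hΦ : IsMoebius Φ cΦ) {x : Eu n} (hx : ⟪p, Ψ x⟫ ≠ 0) :
    Tendsto (fun ε => foldOp Φ Ψ p ε x) (𝓝 0) (𝓝 (foldOp Φ Ψ p 0 x)) := by
  have h1 := ((hΦ.contDiff.continuous_fderiv (by simp)).comp
    (continuous_fold_left p (Ψ x))).continuousAt (x := 0)
  have h3 : ContinuousAt (fun ε => (foldDeriv p ε ⟪p, Ψ x⟫).comp (fderiv ℝ Ψ x)) 0 :=
    (continuousAt_foldDeriv_left p hx).clm_comp continuousAt_const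
  exact (h1.clm_comp h3).tangentOp continuousAt_const

lemma IsMoebius.norm_tangentOp_fderiv {f : Eu n → Eu n} {c : Eu n → ℝ} (hf : IsMoebius f c)
    {x : Eu n} (hx : x ∈ sphSet n) {s : Eu n} (hs : ‖s‖ = 1) :
    ‖tangentOp (fderiv ℝ f x) x s‖ = c x * √(1 - ⟪s, f x⟫ ^ 2) := by
  obtain ⟨hc, R, hR, hRx⟩ := hf.deriv x hx
  have h := norm_tangentOp_similarity (c := c x) hx hRx s
  rw [hR.fderiv, ← Real.sqrt_sq (norm_nonneg (tangentOp _ x s)), h, hs, one_pow,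
    Real.sqrt_mul (sq_nonneg _), Real.sqrt_sq hc.le]

lemma foldOp_zero_of_pos (hΦ : IsMoebius Φ cΦ) (hΨ : IsMoebius Ψ cΨ) {x : Eu n}
    (h : 0 < ⟪p, Ψ x⟫) : foldOp Φ Ψ p 0 x = tangentOp (fderiv ℝ (Φ ∘ Ψ) x) x := by
  rw [foldOp, foldDeriv_zero_of_pos p h, fold_zero_of_nonneg h.le, ContinuousLinearMap.id_comp,
    fderiv_comp x (hΦ.contDiff.differentiable (by simp) _)
      (hΨ.contDiff.differentiable (by simp) _)]

lemma foldOp_zero_of_neg (hΦ : IsMoebius Φ cΦ) (hΨ : IsMoebius Ψ cΨ) (hp : ‖p‖ = 1) {x : Eu n}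
    (h : ⟪p, Ψ x⟫ < 0) : foldOp Φ Ψ p 0 x =
      tangentOp (fderiv ℝ (Φ ∘ (ℝ ∙ p)ᗮ.reflection ∘ Ψ) x) x := by
  have hΨd := hΨ.contDiff.differentiable (by simp) x
  have hR : DifferentiableAt ℝ (ℝ ∙ p)ᗮ.reflection (Ψ x) :=
    ((ℝ ∙ p)ᗮ.reflection : Eu n →L[ℝ] Eu n).differentiableAt
  rw [foldOp, foldDeriv_zero_of_neg hp h, fold_zero_of_nonpos h.le, ← reflection_orthogonal_unit hp,
    fderiv_comp x (hΦ.contDiff.differentiable (by simp) _) (hR.comp x hΨd),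
    fderiv_comp x hR hΨd]
  congr 3
  exact ((ℝ ∙ p)ᗮ.reflection : Eu n →L[ℝ] Eu n).hasFDerivAt.fderiv.symm

lemma ae_inner_comp_ne_zero (hΨ : IsMoebius Ψ cΨ) (hp : ‖p‖ = 1) :
    ∀ᵐ x ∂sphMeasure n, ⟪p, Ψ x⟫ ≠ 0 :=
  hΨ.ae_comp (P := fun y => ⟪p, y⟫ ≠ 0)
    (measurableSet_eq_fun (by fun_prop) measurable_const).compl
    (ae_inner_ne_zero (by rintro rfl; simp at hp))

lemma aestronglyMeasurable_foldOp_zero (hΦ : IsMoebius Φ cΦ) (hΨ : IsMoebius Ψ cΨ) (hp : ‖p‖ = 1) :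
    AEStronglyMeasurable (foldOp Φ Ψ p 0) (sphMeasure n) := by
  refine aestronglyMeasurable_of_tendsto_ae atTop (f := fun k : ℕ => foldOp Φ Ψ p (1 / (k + 1)))
    (fun k => (continuous_foldOp hΦ hΨ (by positivity)).aestronglyMeasurable) ?_
  filter_upwards [ae_inner_comp_ne_zero hΨ hp] with x hx
  exact (tendsto_foldOp hΦ hx).comp tendsto_one_div_add_atTop_nhds_zero_nat

/-- The `n`-energy of a coordinate of a folded conformal map is twice the energy of that
coordinate over the image cap. -/
lemma integral_norm_foldOp_pow (hΦ : IsMoebius Φ cΦ) (hΨ : IsMoebius Ψ cΨ) (hp : ‖p‖ = 1)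
    {Φi : Eu n → Eu n} (hΦi : Continuous Φi) (hinv : ∀ y ∈ sphSet n, Φi (Φ y) = y)
    {s : Eu n} (hs : ‖s‖ = 1) :
    ∫ x, ‖foldOp Φ Ψ p 0 x s‖ ^ n ∂sphMeasure n =
      2 * ∫ z in {z | 0 < ⟪p, Φi z⟫}, √(1 - ⟪s, z⟫ ^ 2) ^ n ∂sphMeasure n := by
  have hU : MeasurableSet {z : Eu n | 0 < ⟪p, Φi z⟫} :=
    (isOpen_lt continuous_const (continuous_const.inner hΦi)).measurableSet
  set R := (ℝ ∙ p)ᗮ.reflection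
  set F : Eu n → ℝ≥0∞ := {z | 0 < ⟪p, Φi z⟫}.indicator
    fun z => ENNReal.ofReal (√(1 - ⟪s, z⟫ ^ 2) ^ n) with hFdef
  have hF : Measurable F := Measurable.indicator (by fun_prop) hU
  have hplus := hΦ.comp hΨ
  have hminus := hΦ.comp ((isMoebius_isometry R).comp hΨ)
  have e1 := hplus.lintegral_comp hF
  have e2 := hminus.lintegral_comp hF
  have key : ∫⁻ x, ENNReal.ofReal (‖foldOp Φ Ψ p 0 x s‖ ^ n) ∂sphMeasure n =
      2 * ∫⁻ z, F z ∂sphMeasure n := by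
    rw [two_mul]
    nth_rewrite 1 [← e1]
    rw [← e2, ← lintegral_add_left]
    · refine lintegral_congr_ae ?_
      filter_upwards [ae_mem_sphSet, ae_inner_comp_ne_zero hΨ hp] with x hx hx0
      have hy := hΨ.bijOn.mapsTo hx
      have hRy : R (Ψ x) ∈ sphSet n := (isMoebius_isometry R).bijOn.mapsTo hy
      have hRp : ⟪p, R (Ψ x)⟫ = -⟪p, Ψ x⟫ := by
        rw [reflection_orthogonal_unit hp, Refl, inner_sub_right, inner_smul_right,
          real_inner_self_eq_norm_sq, hp]
        ring
      simp only [hFdef, Function.comp_apply, indicator, mem_ofPred_eq, hinv _ hy, hinv _ hRy, hRp]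
      rcases hx0.lt_or_gt with h | h
      · rw [foldOp_zero_of_neg hΦ hΨ hp h, hminus.norm_tangentOp_fderiv hx hs, if_neg h.not_gt,
          if_pos (neg_pos.2 h), mul_zero, zero_add, mul_pow,
          ENNReal.ofReal_mul (pow_nonneg (hminus.deriv x hx).1.le _)]
        rfl
      · rw [foldOp_zero_of_pos hΦ hΨ h, hplus.norm_tangentOp_fderiv hx hs, if_pos h,
          if_neg (by linarith), mul_zero, add_zero, mul_pow,
          ENNReal.ofReal_mul (pow_nonneg (hplus.deriv x hx).1.le _)]
        rfl
    · exact (hplus.continuous_factor.measurable.pow_const n).ennreal_ofReal.mul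
        (hF.comp hplus.contDiff.continuous.measurable)
  have hmeas : AEStronglyMeasurable (fun x => foldOp Φ Ψ p 0 x s) (sphMeasure n) :=
    (ContinuousLinearMap.apply ℝ (Eu n) s).continuous.comp_aestronglyMeasurable
      (aestronglyMeasurable_foldOp_zero hΦ hΨ hp)
  rw [integral_eq_lintegral_of_nonneg_ae (Eventually.of_forall fun x => by positivity)
    (f := fun x => ‖foldOp Φ Ψ p 0 x s‖ ^ n) (hmeas.norm.pow n), key, ENNReal.toReal_mul,
    ENNReal.toReal_ofNat, lintegral_indicator hU,
    integral_eq_lintegral_of_nonneg_ae (Eventually.of_forall fun x => by positivity)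
    (by fun_prop)]

end foldOp

lemma integrable_of_continuous {f : Eu n → ℝ} (hf : Continuous f) :
    Integrable f (sphMeasure n) := by
  obtain ⟨C, hC⟩ := (isCompact_sphere (0 : Eu n) 1).exists_bound_of_continuousOn hf.continuousOn
  refine Integrable.of_bound hf.aestronglyMeasurable C ?_
  filter_upwards [ae_mem_sphSet] with x hx using hC x hx

lemma IsConformalFactor.ae_pos {w : Eu n → ℝ} (hw : IsConformalFactor n w) :
    ∀ᵐ x ∂sphMeasure n, 0 < w x := by
  filter_upwards [ae_mem_sphSet] with x hx using hw.2 x hx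

lemma ae_confMeasure {w : Eu n → ℝ} {P : Eu n → Prop} (h : ∀ᵐ x ∂sphMeasure n, P x) :
    ∀ᵐ x ∂confMeasure n w, P x :=
  (withDensity_absolutelyContinuous _ _).ae_le h

lemma integral_confFactor_pow {w : Eu n → ℝ} (hw : IsConformalFactor n w)
    (hvol : confMeasure n w univ = 1) : ∫ x, w x ^ n ∂sphMeasure n = 1 := by
  have hc : Continuous w := hw.1.continuous
  rw [confMeasure, withDensity_apply _ .univ, Measure.restrict_univ] at hvol
  rw [integral_eq_lintegral_of_nonneg_ae (hw.ae_pos.mono fun x hx => (pow_pos hx n).le)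
    (hc.pow n).aestronglyMeasurable, hvol, ENNReal.toReal_one]

lemma dirichlet_nonneg {w : Eu n → ℝ} (hw : IsConformalFactor n w) (V : Eu n → ℝ) :
    0 ≤ dirichlet n w V := by
  refine integral_nonneg_of_ae ?_
  filter_upwards [hw.ae_pos] with x hx
  positivity

lemma lambda2_le {w V W : Eu n → ℝ} (hw : IsConformalFactor n w) (hV : ContDiff ℝ (⊤ : ℕ∞) V)
    (hW : ContDiff ℝ (⊤ : ℕ∞) W) (hV0 : MeanZero n w V) (hW0 : MeanZero n w W) {M : ℝ}
    (hM : 0 ≤ M) (h : ∀ a b : ℝ, ¬(a = 0 ∧ b = 0) → 0 < l2sq n w (fun x => a * V x + b * W x) ∧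
      dirichlet n w (fun x => a * V x + b * W x) ≤ M * l2sq n w (fun x => a * V x + b * W x)) :
    lambda2 n w ≤ M := by
  rw [lambda2]
  refine le_trans (csInf_le ⟨0, ?_⟩ ⟨V, W, hV, hW, hV0, hW0, fun a b hab => ?_, rfl⟩)
    (Real.sSup_le ?_ hM)
  · rintro Λ ⟨V', W', -, -, -, -, -, rfl⟩
    refine Real.sSup_nonneg ?_
    rintro q ⟨a, b, -, rfl⟩
    exact div_nonneg (dirichlet_nonneg hw _) (integral_nonneg fun x => sq_nonneg _)
  · by_contra hne
    refine (h a b hne).1.ne' (integral_eq_zero_of_ae ?_)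
    filter_upwards [ae_confMeasure ae_mem_sphSet] with x hx
    simp [hab x hx]
  · rintro q ⟨a, b, hab, rfl⟩
    obtain ⟨h1, h2⟩ := h a b hab
    exact (div_le_iff₀ h1).2 h2

lemma Qform_smul (ν : Measure (Eu n)) (c : ℝ) (s : Eu n) : Qform ν (c • s) = c ^ 2 * Qform ν s := by
  simp [Qform, inner_smul_left, mul_pow, integral_const_mul]

section Qform

variable {ν : Measure (Eu n)} [IsProbabilityMeasure ν]

lemma integrable_inner_mul (hν : ∀ᵐ x ∂ν, x ∈ sphSet n) (s t : Eu n) :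
    Integrable (fun x => ⟪s, x⟫ * ⟪t, x⟫) ν := by
  refine Integrable.of_bound (C := ‖s‖ * ‖t‖) (by fun_prop) ?_
  filter_upwards [hν] with x hx
  rw [mem_sphSet] at hx
  rw [norm_mul]
  have h1 : ‖⟪s, x⟫‖ ≤ ‖s‖ := by simpa [hx] using norm_inner_le_norm (𝕜 := ℝ) s x
  have h2 : ‖⟪t, x⟫‖ ≤ ‖t‖ := by simpa [hx] using norm_inner_le_norm (𝕜 := ℝ) t x
  gcongr

lemma integrable_inner_sq (hν : ∀ᵐ x ∂ν, x ∈ sphSet n) (s : Eu n) :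
    Integrable (fun x => ⟪s, x⟫ ^ 2) ν := by
  simpa only [sq] using integrable_inner_mul hν s s

lemma Qform_le (hν : ∀ᵐ x ∂ν, x ∈ sphSet n) (s : Eu n) : Qform ν s ≤ maxEig n ν * ‖s‖ ^ 2 := by
  by_cases hs : s = 0
  · simp [hs, Qform]
  have hs' : ‖s‖ ≠ 0 := norm_ne_zero_iff.2 hs
  have hbdd : BddAbove {q : ℝ | ∃ s : Eu n, ‖s‖ = 1 ∧ q = Qform ν s} := by
    refine ⟨1, ?_⟩
    rintro q ⟨s, hs, rfl⟩
    have : Qform ν s ≤ ∫ _, (1 : ℝ) ∂ν := by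
      refine integral_mono_ae (integrable_inner_sq hν s) (integrable_const _) ?_
      filter_upwards [hν] with x hx
      rw [mem_sphSet] at hx
      exact (sq_le_one_iff_abs_le_one _).2 (by simpa [hs, hx] using abs_real_inner_le_norm s x)
    simpa using this
  have h1 : Qform ν (‖s‖⁻¹ • s) ≤ maxEig n ν :=
    le_csSup hbdd ⟨_, mem_sphSet.1 (smul_inv_norm_mem hs), rfl⟩
  rw [Qform_smul, inv_pow, inv_mul_le_iff₀ (by positivity)] at h1
  linarith

lemma one_le_maxEig (hν : ∀ᵐ x ∂ν, x ∈ sphSet n) : 1 ≤ (n + 1) * maxEig n ν := by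
  have h1 : ∑ i, Qform ν (EuclideanSpace.basisFun (Fin (n + 1)) ℝ i) = 1 := by
    simp only [Qform]
    rw [← integral_finsetSum _ fun i _ => integrable_inner_sq hν _]
    have : (1 : ℝ) = ∫ _, (1 : ℝ) ∂ν := by simp
    rw [this]
    refine integral_congr_ae ?_
    filter_upwards [hν] with x hx
    have := (EuclideanSpace.basisFun (Fin (n + 1)) ℝ).sum_sq_norm_inner_right x
    simpa only [Real.norm_eq_abs, sq_abs, mem_sphSet.1 hx, one_pow] using this
  have h2 := Finset.sum_le_sum fun i (_ : i ∈ Finset.univ) =>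
    Qform_le hν (EuclideanSpace.basisFun (Fin (n + 1)) ℝ i)
  rw [h1] at h2
  simpa using h2

lemma Qform_parallelogram (hν : ∀ᵐ x ∂ν, x ∈ sphSet n) (s t : Eu n) :
    Qform ν (s + t) + Qform ν (s - t) = 2 * Qform ν s + 2 * Qform ν t := by
  simp only [Qform]
  rw [← integral_add (integrable_inner_sq hν _) (integrable_inner_sq hν _), ← integral_const_mul,
    ← integral_const_mul, ← integral_add ((integrable_inner_sq hν _).const_mul _)
      ((integrable_inner_sq hν _).const_mul _)]
  refine integral_congr_ae (Eventually.of_forall fun x => ?_)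
  simp only [inner_add_left, inner_sub_left]
  ring

lemma Qform_add_of_eq_maxEig (hν : ∀ᵐ x ∂ν, x ∈ sphSet n) {s t : Eu n}
    (hs : Qform ν s = maxEig n ν * ‖s‖ ^ 2) (ht : Qform ν t = maxEig n ν * ‖t‖ ^ 2) (a b : ℝ) :
    Qform ν (a • s + b • t) = maxEig n ν * ‖a • s + b • t‖ ^ 2 := by
  have h1 := Qform_parallelogram hν (a • s) (b • t)
  have h2 := parallelogram_law_with_norm ℝ (a • s) (b • t)
  have h3 := Qform_le hν (a • s + b • t)
  have h4 := Qform_le hν (a • s - b • t)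
  have ha : Qform ν (a • s) = maxEig n ν * ‖a • s‖ ^ 2 := by
    rw [Qform_smul, hs, norm_smul, mul_pow, Real.norm_eq_abs, sq_abs]; ring
  have hb : Qform ν (b • t) = maxEig n ν * ‖b • t‖ ^ 2 := by
    rw [Qform_smul, ht, norm_smul, mul_pow, Real.norm_eq_abs, sq_abs]; ring
  have h5 : maxEig n ν * ‖a • s + b • t‖ ^ 2 + maxEig n ν * ‖a • s - b • t‖ ^ 2 =
      2 * (maxEig n ν * ‖a • s‖ ^ 2) + 2 * (maxEig n ν * ‖b • t‖ ^ 2) := by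
    linear_combination maxEig n ν * h2
  linarith

end Qform

lemma cap_eq {r : ℝ} {p : Eu n} (hr : ‖r • p‖ < 1) :
    cap n r p = sphSet n ∩ {x | 0 < ⟪p, mob (-(r • p)) x⟫} := by
  ext x
  constructor
  · rintro ⟨y, ⟨hy, hpy⟩, rfl⟩
    rw [dMap_eq_mob hr hy]
    exact ⟨mob_mem hr hy, by simpa [mob_neg_mob hr hy] using hpy⟩
  · rintro ⟨hx, hpx⟩
    have hy : mob (-(r • p)) x ∈ sphSet n := mob_mem (by simpa using hr) hx
    exact ⟨_, ⟨hy, hpx⟩, by rw [dMap_eq_mob hr hy, mob_mob_neg hr hx]⟩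

lemma measurable_dMap (ξ : Eu n) : Measurable (dMap ξ) := by
  unfold dMap; fun_prop

lemma measurable_Refl (p : Eu n) : Measurable (Refl p) := by
  unfold Refl; fun_prop

/-- The renormalised cap measure is the push-forward of `dv_g` under the folded conformal map. -/
lemma map_capMeasure (w : Eu n → ℝ) {r : ℝ} {p ξ : Eu n} (hp : ‖p‖ = 1) (hr : ‖r • p‖ < 1)
    (hξ : ‖ξ‖ < 1) : Measure.map (dMap ξ) (capMeasure n w r p) =
      Measure.map (fun x => mob ξ (mob (r • p) (fold p 0 (mob (-(r • p)) x))))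
        (confMeasure n w) := by
  have hr' : ‖-(r • p)‖ < 1 := by simpa using hr
  have hΨ : Continuous (mob (-(r • p))) := (contDiff_mob hr').continuous
  have hT : Measurable fun x => mob ξ (mob (r • p) (fold p 0 (mob (-(r • p)) x))) :=
    ((contDiff_mob hξ).continuous.comp ((contDiff_mob hr).continuous.comp
      ((continuous_fold p 0).comp hΨ))).measurable
  have hτ : Measurable (tauMap r p) :=
    (measurable_dMap _).comp ((measurable_Refl p).comp (measurable_dMap _))
  have hP : MeasurableSet {x | 0 < ⟪p, mob (-(r • p)) x⟫} :=
    (isOpen_lt continuous_const (continuous_const.inner hΨ)).measurableSet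
  have hcap : MeasurableSet (cap n r p) := by
    rw [cap_eq hr]; exact measurableSet_sphSet.inter hP
  have h0 : ∀ᵐ x ∂confMeasure n w, x ∈ sphSet n ∧ ⟪p, mob (-(r • p)) x⟫ ≠ 0 := by
    refine ae_confMeasure (ae_mem_sphSet.and ?_)
    exact (isMoebius_mob hr').ae_comp (P := fun y => ⟪p, y⟫ ≠ 0)
      (measurableSet_eq_fun (by fun_prop) measurable_const).compl
      (ae_inner_ne_zero (by rintro rfl; simp at hp))
  ext E hE
  have hDE := measurable_dMap ξ hE
  rw [Measure.map_apply (measurable_dMap ξ) hE, Measure.map_apply hT hE,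
    ← measure_inter_add_sdiff (μ := confMeasure n w) _ hP, capMeasure, Measure.restrict_apply hDE,
    Measure.add_apply, Measure.map_apply hτ (hDE.inter hcap)]
  have hΨx : ∀ x ∈ sphSet n, mob (-(r • p)) x ∈ sphSet n := fun x hx => mob_mem hr' hx
  refine congrArg₂ (· + ·) (measure_congr (eventuallyEq_set.2 ?_))
    (measure_congr (eventuallyEq_set.2 ?_))
  · filter_upwards [h0] with x ⟨hx, _⟩
    rw [cap_eq hr]
    simp only [mem_inter_iff, mem_preimage, mem_ofPred_eq, hx, true_and]
    refine and_congr_left fun h => ?_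
    rw [fold_zero_of_nonneg h.le, mob_mob_neg hr hx, dMap_eq_mob hξ hx]
  · filter_upwards [h0] with x ⟨hx, hx0⟩
    have hy : Refl p (mob (-(r • p)) x) ∈ sphSet n := by
      rw [← reflection_orthogonal_unit hp, mem_sphSet, LinearIsometryEquiv.norm_map]
      exact mem_sphSet.1 (hΨx x hx)
    have hτx : tauMap r p x = mob (r • p) (Refl p (mob (-(r • p)) x)) := by
      simp only [tauMap, Function.comp_apply, dMap_eq_mob hr' hx, dMap_eq_mob hr hy]
    have hτS : tauMap r p x ∈ sphSet n := hτx ▸ mob_mem hr hy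
    have hpy : ⟪p, Refl p (mob (-(r • p)) x)⟫ = -⟪p, mob (-(r • p)) x⟫ := by
      rw [Refl, inner_sub_right, inner_smul_right, real_inner_self_eq_norm_sq, hp]
      ring
    rw [cap_eq hr]
    simp only [mem_inter_iff, Set.mem_sdiff, mem_preimage, mem_ofPred_eq, hτS, true_and, not_lt]
    rw [dMap_eq_mob hξ hτS, hτx, mob_neg_mob hr hy, hpy, neg_pos]
    constructor
    · rintro ⟨h1, h2⟩
      exact ⟨by rwa [fold_zero_of_nonpos h2.le], h2.le⟩
    · rintro ⟨h1, h2⟩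
      exact ⟨by rwa [fold_zero_of_nonpos h2] at h1, lt_of_le_of_ne h2 hx0⟩

section foldedMap

variable {w : Eu n → ℝ} {Φ Ψ : Eu n → Eu n} {cΦ cΨ : Eu n → ℝ} {p : Eu n}

lemma exists_energy_bound (hn : 2 ≤ n) (hw : IsConformalFactor n w)
    (hvol : confMeasure n w univ = 1) (hΦ : IsMoebius Φ cΦ) (hΨ : IsMoebius Ψ cΨ) (hp : ‖p‖ = 1)
    {Φi : Eu n → Eu n} (hΦi : Continuous Φi) (hinv : ∀ y ∈ sphSet n, Φi (Φ y) = y) :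
    ∃ s₀ : Eu n, ‖s₀‖ = 1 ∧ ∃ M : ℝ, 0 ≤ M ∧
      M < (2 * ∫ z, √(1 - ⟪s₀, z⟫ ^ 2) ^ n ∂sphMeasure n) ^ ((2 : ℝ) / n) ∧
      ∀ s, ∫ x, w x ^ (n - 2) * ‖foldOp Φ Ψ p 0 x s‖ ^ 2 ∂sphMeasure n ≤ M * ‖s‖ ^ 2 := by
  have hUo : IsOpen {z : Eu n | 0 < ⟪p, Φi z⟫} :=
    isOpen_lt continuous_const (continuous_const.inner hΦi)
  have hVo : IsOpen {z : Eu n | ⟪p, Φi z⟫ < 0} :=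
    isOpen_lt (continuous_const.inner hΦi) continuous_const
  have hnp : -p ∈ sphSet n := by simpa [mem_sphSet] using hp
  have hUc : 0 < sphMeasure n {z : Eu n | 0 < ⟪p, Φi z⟫}ᶜ := by
    refine (sphMeasure_pos_of_isOpen hVo (hΦ.bijOn.mapsTo hnp) ?_).trans_le
      (measure_mono fun z hz => ?_)
    · simp [hinv _ hnp, hp]
    · simp only [mem_compl_iff, mem_ofPred_eq, not_lt] at hz ⊢
      exact hz.le
  obtain ⟨s₀, hs₀, hmax, hlt⟩ := exists_max_partial_energy (by omega) hUo.measurableSet hUc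
  have hJ0 : 0 ≤ ∫ z in {z : Eu n | 0 < ⟪p, Φi z⟫}, √(1 - ⟪s₀, z⟫ ^ 2) ^ n ∂sphMeasure n :=
    integral_nonneg fun z => by positivity
  have hn0 : (0 : ℝ) < n := by positivity
  refine ⟨s₀, hs₀, (2 * ∫ z in {z : Eu n | 0 < ⟪p, Φi z⟫},
    √(1 - ⟪s₀, z⟫ ^ 2) ^ n ∂sphMeasure n) ^ ((2 : ℝ) / n), by positivity,
    Real.rpow_lt_rpow (by positivity) (by linarith) (by positivity), fun s => ?_⟩
  obtain ⟨C, hC⟩ := exists_norm_foldOp_le hΦ hΨ hp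
  have hunit : ∀ s : Eu n, ‖s‖ = 1 →
      ∫ x, w x ^ (n - 2) * ‖foldOp Φ Ψ p 0 x s‖ ^ 2 ∂sphMeasure n ≤
      (2 * ∫ z in {z : Eu n | 0 < ⟪p, Φi z⟫}, √(1 - ⟪s₀, z⟫ ^ 2) ^ n ∂sphMeasure n) ^
        ((2 : ℝ) / n) := by
    intro s hs
    have hm : AEStronglyMeasurable (fun x => ‖foldOp Φ Ψ p 0 x s‖) (sphMeasure n) :=
      ((ContinuousLinearMap.apply ℝ (Eu n) s).continuous.comp_aestronglyMeasurable
        (aestronglyMeasurable_foldOp_zero hΦ hΨ hp)).norm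
    have hbd : ∀ᵐ x ∂sphMeasure n, ‖‖foldOp Φ Ψ p 0 x s‖ ^ n‖ ≤ C ^ n := by
      filter_upwards [ae_mem_sphSet] with x hx
      rw [norm_pow, norm_norm]
      gcongr
      refine ((foldOp Φ Ψ p 0 x).le_opNorm s).trans ?_
      rw [hs, mul_one]
      exact hC 0 (by simp) x hx
    refine (integral_pow_mul_sq_le hn (hw.ae_pos.mono fun x hx => hx.le)
      (Eventually.of_forall fun x => norm_nonneg _) hw.1.continuous.aestronglyMeasurable hm
      (integrable_of_continuous (hw.1.continuous.pow n)) (Integrable.of_bound (hm.pow n) _ hbd)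
      (integral_confFactor_pow hw hvol)).trans ?_
    rw [integral_norm_foldOp_pow hΦ hΨ hp hΦi hinv hs]
    refine Real.rpow_le_rpow ?_ ?_ (by positivity)
    · exact mul_nonneg two_pos.le (integral_nonneg fun z => by positivity)
    · linarith [hmax s hs]
  by_cases hs : s = 0
  · simp [hs]
  have h1 := hunit _ (mem_sphSet.1 (smul_inv_norm_mem hs))
  have e : ∀ x, w x ^ (n - 2) * ‖foldOp Φ Ψ p 0 x (‖s‖⁻¹ • s)‖ ^ 2 =
      (‖s‖⁻¹) ^ 2 * (w x ^ (n - 2) * ‖foldOp Φ Ψ p 0 x s‖ ^ 2) := by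
    intro x
    rw [map_smul, norm_smul, norm_inv, norm_norm]
    ring
  simp only [e] at h1
  have hs' : 0 < ‖s‖ := norm_pos_iff.2 hs
  rw [integral_const_mul, inv_pow, inv_mul_le_iff₀ (by positivity)] at h1
  linarith

lemma exists_norm_folded_le (hΦ : IsMoebius Φ cΦ) (hΨ : IsMoebius Ψ cΨ) (hp : ‖p‖ = 1) :
    ∃ C : ℝ, ∀ ε, |ε| ≤ 1 → ∀ x ∈ sphSet n, ‖Φ (fold p ε (Ψ x))‖ ≤ C := by
  obtain ⟨C, hC⟩ := (isCompact_closedBall (0 : Eu n) 4).exists_bound_of_continuousOn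
    hΦ.contDiff.continuous.continuousOn
  exact ⟨C, fun ε hε x hx => hC _ (by simpa using norm_fold_le hp hε (hΨ.bijOn.mapsTo hx))⟩

/-- The second eigenvalue bound obtained from a plane of test functions built from a folded
conformal map whose push-forward measure is centred and has a multiple maximal eigenvalue. -/
lemma lambda2_lt_of_folded (hn : 2 ≤ n) (hw : IsConformalFactor n w)
    (hvol : confMeasure n w univ = 1) (hΦ : IsMoebius Φ cΦ) (hΨ : IsMoebius Ψ cΨ) (hp : ‖p‖ = 1)
    {Φi : Eu n → Eu n} (hΦi : Continuous Φi) (hinv : ∀ y ∈ sphSet n, Φi (Φ y) = y)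
    (hmean : ∫ x, Φ (fold p 0 (Ψ x)) ∂confMeasure n w = 0)
    (hmult : IsMultiple (Measure.map (fun x => Φ (fold p 0 (Ψ x))) (confMeasure n w))) :
    lambda2 n w < Kconst n * n * (2 * sigmaVol n) ^ ((2 : ℝ) / n) := by
  have hprob : IsProbabilityMeasure (confMeasure n w) := ⟨hvol⟩
  have hTc : ∀ ε, Continuous fun x => Φ (fold p ε (Ψ x)) := fun ε =>
    hΦ.contDiff.continuous.comp ((continuous_fold p ε).comp hΨ.contDiff.continuous)
  have hνprob := Measure.isProbabilityMeasure_map (μ := confMeasure n w) (hTc 0).aemeasurable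
  have hν : ∀ᵐ x ∂Measure.map (fun x => Φ (fold p 0 (Ψ x))) (confMeasure n w), x ∈ sphSet n := by
    refine (ae_map_iff (hTc 0).aemeasurable measurableSet_sphSet).2 (ae_confMeasure ?_)
    filter_upwards [ae_mem_sphSet] with x hx
    exact hΦ.bijOn.mapsTo (fold_zero_mem hp (hΨ.bijOn.mapsTo hx))
  obtain ⟨s, t, hs, ht, hli⟩ := hmult
  have hQ := fun a b : ℝ => Qform_add_of_eq_maxEig hν hs ht a b
  have hq := one_le_maxEig hν
  set q := maxEig n (Measure.map (fun x => Φ (fold p 0 (Ψ x))) (confMeasure n w))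
  replace hQ : ∀ a b : ℝ, ∫ x, ⟪a • s + b • t, Φ (fold p 0 (Ψ x))⟫ ^ 2 ∂confMeasure n w =
      q * ‖a • s + b • t‖ ^ 2 := by
    intro a b
    rw [← hQ a b, Qform, integral_map (hTc 0).aemeasurable (by fun_prop)]
  obtain ⟨s₀, hs₀, M, hM0, hM, hE⟩ := exists_energy_bound hn hw hvol hΦ hΨ hp hΦi hinv
  rw [Kconst_eq (by omega) hs₀]
  set I := (2 * ∫ z, √(1 - ⟪s₀, z⟫ ^ 2) ^ n ∂sphMeasure n) ^ ((2 : ℝ) / n)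
  have hne := ae_inner_comp_ne_zero hΨ hp
  let ε : ℕ → ℝ := fun k => 1 / (k + 1)
  have hε0 : ∀ k, ε k ≠ 0 := fun k => by positivity
  have hε1 : ∀ k, |ε k| ≤ 1 := fun k => by
    rw [abs_of_nonneg (by positivity)]
    exact div_le_one_of_le₀ (by linarith [(Nat.cast_nonneg k : (0 : ℝ) ≤ k)]) (by positivity)
  have hεlim : Tendsto ε atTop (𝓝 0) := tendsto_one_div_add_atTop_nhds_zero_nat
  obtain ⟨C, hC⟩ := exists_norm_foldOp_le hΦ hΨ hp
  obtain ⟨C', hC'⟩ := exists_norm_folded_le hΦ hΨ hp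
  obtain ⟨η, hη, hηb⟩ := exists_tendsto_quadratic_bound
    (ω := fun x => w x ^ (n - 2)) (integrable_of_continuous (hw.1.continuous.pow (n - 2)))
    (B := fun k => foldOp Φ Ψ p (ε k)) (B₀ := foldOp Φ Ψ p 0) (C := C)
    (fun k => (continuous_foldOp hΦ hΨ (hε0 k)).aestronglyMeasurable)
    (by filter_upwards [ae_mem_sphSet] with x hx k using hC _ (hε1 k) x hx)
    (by filter_upwards [hne] with x hx using (tendsto_foldOp hΦ hx).comp hεlim)
  let m : ℕ → Eu n := fun k => ∫ x, Φ (fold p (ε k) (Ψ x)) ∂confMeasure n w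
  have hTlim : ∀ x, Tendsto (fun k => Φ (fold p (ε k) (Ψ x))) atTop (𝓝 (Φ (fold p 0 (Ψ x)))) :=
    fun x => ((hΦ.contDiff.continuous.comp (continuous_fold_left p (Ψ x))).tendsto 0).comp hεlim
  have hTb : ∀ k, ∀ᵐ x ∂confMeasure n w, ‖Φ (fold p (ε k) (Ψ x))‖ ≤ C' := fun k =>
    ae_confMeasure (by filter_upwards [ae_mem_sphSet] with x hx using hC' _ (hε1 k) x hx)
  have hTi : ∀ k, Integrable (fun x => Φ (fold p (ε k) (Ψ x))) (confMeasure n w) := fun k =>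
    Integrable.of_bound (hTc _).aestronglyMeasurable C' (hTb k)
  have hmb : ∀ k, ‖m k‖ ≤ C' := fun k => by
    simpa [Measure.real, hvol] using norm_integral_le_of_norm_le_const (hTb k)
  have hm : Tendsto m atTop (𝓝 0) := by
    rw [← hmean]
    exact tendsto_integral_of_dominated_convergence (fun _ => C')
      (fun k => (hTc _).aestronglyMeasurable) (integrable_const _) hTb
      (Eventually.of_forall hTlim)
  obtain ⟨θ, hθ, hθb⟩ := exists_tendsto_quadratic_bound
    (integrable_const (1 : ℝ) : Integrable _ (confMeasure n w))
    (B := fun k x => innerSL ℝ (Φ (fold p (ε k) (Ψ x)) - m k))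
    (B₀ := fun x => innerSL ℝ (Φ (fold p 0 (Ψ x)))) (C := C' + C')
    (fun k => ((innerSL ℝ).continuous.comp ((hTc _).sub continuous_const)).aestronglyMeasurable)
    (by
      filter_upwards [ae_all_iff.2 hTb] with x hx k
      rw [innerSL_apply_norm]
      exact (norm_sub_le _ _).trans (add_le_add (hx k) (hmb k)))
    (by
      refine Eventually.of_forall fun x => ((innerSL ℝ).continuous.tendsto _).comp ?_
      simpa using (hTlim x).sub hm)
  let V : ℕ → Eu n → Eu n → ℝ := fun k u x => ⟪u, Φ (fold p (ε k) (Ψ x))⟫ - ⟪u, m k⟫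
  have hVlin : ∀ (k : ℕ) (a b : ℝ), (fun x => a * V k s x + b * V k t x) = V k (a • s + b • t) := by
    intro k a b
    ext x
    simp only [V, inner_add_left, real_inner_smul_left]
    ring
  have hVs : ∀ k u, ContDiff ℝ (⊤ : ℕ∞) (V k u) := fun k u =>
    (contDiff_const.inner ℝ (hΦ.contDiff.comp ((contDiff_fold p (hε0 k)).comp hΨ.contDiff))).sub
      contDiff_const
  have hV0 : ∀ k u, MeanZero n w (V k u) := by
    intro k u
    rw [MeanZero, integral_sub ((hTi k).const_inner u) (integrable_const _),
      integral_inner (hTi k) u]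
    simp [m]
  have hdir : ∀ k u, dirichlet n w (V k u) ≤ (M + |η k|) * ‖u‖ ^ 2 := by
    intro k u
    have e : dirichlet n w (V k u) =
        ∫ x, w x ^ (n - 2) * ‖foldOp Φ Ψ p (ε k) x u‖ ^ 2 ∂sphMeasure n := by
      simp only [dirichlet, V, gradS_fold hΦ hΨ (hε0 k)]
    have h1 := (abs_le.1 (hηb k u)).2
    have h2 := mul_le_mul_of_nonneg_right (le_abs_self (η k)) (sq_nonneg ‖u‖)
    rw [e]
    linarith [hE u]
  have hl2 : ∀ (k : ℕ) (a b : ℝ),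
      (q - θ k) * ‖a • s + b • t‖ ^ 2 ≤ l2sq n w (V k (a • s + b • t)) := by
    intro k a b
    have h1 := (abs_le.1 (hθb k (a • s + b • t))).1
    simp only [one_mul, innerSL_apply_apply, Real.norm_eq_abs, sq_abs, inner_sub_left] at h1
    simp only [real_inner_comm (a • s + b • t), hQ] at h1
    simp only [l2sq, V]
    linarith
  have hq0 : 0 < q := by
    by_contra! h
    have : ((n : ℝ) + 1) * q ≤ 0 := mul_nonpos_of_nonneg_of_nonpos (by positivity) h
    linarith
  have hlt : M / q < (n + 1) * I := by
    rw [div_lt_iff₀ hq0]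
    have : 0 < I := hM0.trans_lt hM
    nlinarith
  have hden : Tendsto (fun k => q - θ k) atTop (𝓝 q) := by simpa using hθ.const_sub q
  have hrat : Tendsto (fun k => (M + |η k|) / (q - θ k)) atTop (𝓝 (M / q)) := by
    have : Tendsto (fun k => M + |η k|) atTop (𝓝 M) := by simpa using hη.abs.const_add M
    exact this.div hden hq0.ne'
  obtain ⟨k, hk1, hk2⟩ :=
    ((hrat.eventually_lt_const hlt).and (hden.eventually_const_lt hq0)).exists
  refine (lambda2_le hw (hVs k s) (hVs k t) (hV0 k s) (hV0 k t) (by positivity)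
    fun a b hab => ?_).trans_lt hk1
  have hu : a • s + b • t ≠ 0 := fun h => hab (LinearIndependent.pair_iff.1 hli a b h)
  have hu' : 0 < ‖a • s + b • t‖ := norm_pos_iff.2 hu
  rw [hVlin]
  refine ⟨lt_of_lt_of_le (by positivity) (hl2 k a b), (hdir k _).trans ?_⟩
  rw [div_mul_eq_mul_div, le_div_iff₀ hk2, mul_assoc]
  refine mul_le_mul_of_nonneg_left ?_ (by positivity)
  linarith [hl2 k a b]

end foldedMap

end multipleCap

/-- If `g` is conformal to `g₀` of volume 1 and some renormalized measure
`ν_a` is multiple, then `λ₂(S^n,g) < K_n n (2σ_n)^{2/n}`. -/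
theorem multiple_cap_measure_bound (n : ℕ) (hn : 2 ≤ n)
    (w : Eu n → ℝ) (hw : IsConformalFactor n w) (hvol : confMeasure n w Set.univ = 1)
    (r : ℝ) (hr : r ∈ Set.Ioo (-1 : ℝ) 1) (p : Eu n) (hp : p ∈ sphSet n)
    (ξ : Eu n) (hξ : ‖ξ‖ < 1) (hren : Renormalizes ξ (capMeasure n w r p))
    (hmult : IsMultiple (Measure.map (dMap ξ) (capMeasure n w r p))) :
    lambda2 n w < Kconst n * n * (2 * sigmaVol n) ^ ((2 : ℝ) / n) := by
  rw [mem_sphSet] at hp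
  have hrp : ‖r • p‖ < 1 := by
    rw [norm_smul, hp, mul_one, Real.norm_eq_abs]
    exact abs_lt.2 hr
  have hrp' : ‖-(r • p)‖ < 1 := by simpa using hrp
  have hξ' : ‖-ξ‖ < 1 := by simpa using hξ
  have hΦ := (isMoebius_mob hξ).comp (isMoebius_mob hrp)
  have hΨ := isMoebius_mob hrp'
  have hmap := map_capMeasure w hp hrp hξ
  have hprob : IsProbabilityMeasure (confMeasure n w) := ⟨hvol⟩
  have hT : Continuous fun x => mob ξ (mob (r • p) (fold p 0 (mob (-(r • p)) x))) :=
    hΦ.contDiff.continuous.comp ((continuous_fold p 0).comp hΨ.contDiff.continuous)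
  refine lambda2_lt_of_folded hn hw hvol hΦ hΨ hp
    (Φi := mob (-(r • p)) ∘ mob (-ξ))
    ((contDiff_mob hrp').continuous.comp (contDiff_mob hξ').continuous) (fun y hy => ?_) ?_
    (hmap ▸ hmult)
  · simp only [Function.comp_apply]
    rw [mob_neg_mob hξ (mob_mem hrp hy), mob_neg_mob hrp hy]
  · obtain ⟨C, hC⟩ := exists_norm_folded_le hΦ hΨ hp
    have hint := Integrable.of_bound (μ := confMeasure n w) hT.aestronglyMeasurable C
      (ae_confMeasure (by filter_upwards [ae_mem_sphSet] with x hx using hC 0 (by simp) x hx))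
    by_contra hne
    set v := ∫ x, (mob ξ ∘ mob (r • p)) (fold p 0 (mob (-(r • p)) x)) ∂confMeasure n w with hv
    have h1 := hren _ (smul_inv_norm_mem hne)
    have h2 : ∫ x, Xfun (‖v‖⁻¹ • v) (dMap ξ x) ∂capMeasure n w r p =
        ⟪‖v‖⁻¹ • v, v⟫ := by
      have hX : Continuous (Xfun (‖v‖⁻¹ • v)) := by unfold Xfun; fun_prop
      rw [← integral_map (measurable_dMap ξ).aemeasurable hX.aestronglyMeasurable, hmap,
        integral_map hT.aemeasurable hX.aestronglyMeasurable]
      exact integral_inner hint _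
    rw [h2, real_inner_smul_left, real_inner_self_eq_norm_sq] at h1
    have : ‖v‖ ≠ 0 := norm_ne_zero_iff.2 hne
    field_simp at h1
    exact this h1

end
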